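/- For all r,p,q ∈ [1,+∞): (1) E(C[0,1],p) is Borel bireducible with E(c₀,p); (2) E(L_r,p) is Borel reducible to E(c₀,p); (3) E(c₀,p) is not Borel reducible to E(L_r,q); (4) if p < q then E(c₀,p) is Borel reducible to E(c₀,q) but E(c₀,q) is not Borel reducible to E(c₀,p). -/

import Mathlib

open Filter Topology MeasureTheory
open scoped ENNReal NNReal

noncomputable section

/-- `E` is Borel reducible to `F`: there is a Borel (measurable) map `θ` such that
`E x y ↔ F (θ x) (θ y)` for all `x, y`. -/
def BorelReducible {α β : Type*} [MeasurableSpace α] [MeasurableSpace β]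
    (E : α → α → Prop) (F : β → β → Prop) : Prop :=
  ∃ θ : α → β, Measurable θ ∧ ∀ x y, E x y ↔ F (θ x) (θ y)

/-- Borel bireducibility: reductions in both directions. -/
def BorelBireducible {α β : Type*} [MeasurableSpace α] [MeasurableSpace β]
    (E : α → α → Prop) (F : β → β → Prop) : Prop :=
  BorelReducible E F ∧ BorelReducible F E

/-- The sequence space `ℓ_r` of real sequences with summable `r`-th power. -/
abbrev ellSp (r : ℝ) : Type := lp (fun _ : ℕ => ℝ) (ENNReal.ofReal r)

/-- The Lebesgue space `L_r[0,1]` (with respect to Lebesgue measure on `[0,1]`). -/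
abbrev LSp (r : ℝ) : Type :=
  MeasureTheory.Lp ℝ (ENNReal.ofReal r) ((volume : Measure ℝ).restrict (Set.Icc 0 1))

/-- The equivalence relation `E(X,p)` on `X^ℕ`:
`x ~ y` iff `Σ_n ‖x n - y n‖^p < ∞`. -/
def ESum (X : Type*) [NormedAddCommGroup X] (p : ℝ) : (ℕ → X) → (ℕ → X) → Prop :=
  fun x y => Summable fun n => ‖x n - y n‖ ^ p

noncomputable instance {E : ℕ → Type*} [∀ i, NormedAddCommGroup (E i)] (p : ℝ≥0∞)
    [Fact (1 ≤ p)] : MeasurableSpace (lp E p) := borel _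
instance {E : ℕ → Type*} [∀ i, NormedAddCommGroup (E i)] (p : ℝ≥0∞)
    [Fact (1 ≤ p)] : BorelSpace (lp E p) := ⟨rfl⟩

noncomputable instance {α : Type*} [MeasurableSpace α] (μ : Measure α) (p : ℝ≥0∞)
    [Fact (1 ≤ p)] : MeasurableSpace (Lp ℝ p μ) := borel _
instance {α : Type*} [MeasurableSpace α] (μ : Measure α) (p : ℝ≥0∞)
    [Fact (1 ≤ p)] : BorelSpace (Lp ℝ p μ) := ⟨rfl⟩

open ZeroAtInfty in
/-- The Banach space `c₀` of real sequences converging to `0`, with the sup norm. -/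
abbrev cZeroSp : Type := C₀(ℕ, ℝ)

/-- The Banach space `C[0,1]` of continuous functions with the sup norm. -/
abbrev CunitSp : Type := C(Set.Icc (0:ℝ) 1, ℝ)

noncomputable instance : MeasurableSpace cZeroSp := borel _
instance : BorelSpace cZeroSp := ⟨rfl⟩
noncomputable instance : MeasurableSpace CunitSp := borel _
instance : BorelSpace CunitSp := ⟨rfl⟩

theorem c0_norm_le {f : cZeroSp} {C : ℝ} (hC : 0 ≤ C) (h : ∀ n, |f n| ≤ C) : ‖f‖ ≤ C := by
  rw [← ZeroAtInftyContinuousMap.norm_toBCF_eq_norm]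
  exact (BoundedContinuousFunction.norm_le hC).2 (fun n => by simpa using h n)

theorem c0_le_norm (f : cZeroSp) (n : ℕ) : |f n| ≤ ‖f‖ := by
  rw [← ZeroAtInftyContinuousMap.norm_toBCF_eq_norm]
  simpa using BoundedContinuousFunction.norm_coe_le_norm f.toBCF n

/-- build an element of c0 from a function on a countable type with finite superlevel sets -/
theorem c0_mk_exists {ι : Type*} [Countable ι] (F : ι → ℝ)
    (hF : ∀ ε > 0, {i | ε ≤ |F i|}.Finite) (φ : ι → ℕ) (hφ : Function.Injective φ) :
    ∃ f : cZeroSp, (∀ i, f (φ i) = F i) ∧ ∀ n, n ∉ Set.range φ → f n = 0 := by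
  classical
  refine ⟨⟨⟨Function.extend φ F 0, continuous_of_discreteTopology⟩, ?_⟩, ?_, ?_⟩
  · rw [cocompact_eq_cofinite, Metric.tendsto_nhds]
    intro ε hε
    rw [Filter.eventually_cofinite]
    refine ((hF ε hε).image φ).subset ?_
    intro n hn
    by_cases h : n ∈ Set.range φ
    · obtain ⟨i, rfl⟩ := h
      refine ⟨i, ?_, rfl⟩
      simpa [hφ.extend_apply] using hn
    · exfalso
      apply hn
      have : Function.extend φ F 0 n = 0 := by
        rw [Function.extend_apply' _ _ _ (by simpa using h)]; rfl
      simp [this, hε]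
  · intro i
    exact hφ.extend_apply F 0 i
  · intro n h
    show Function.extend φ F 0 n = 0
    rw [Function.extend_apply' _ _ _ (by simpa using h)]; rfl

/-- Aharoni's embedding theorem (with a crude constant). -/
theorem aharoni {X : Type*} (δ : X → X → ℝ) (h0 : ∀ x, δ x x = 0) (hs : ∀ x y, δ x y = δ y x)
    (ht : ∀ x y z, δ x z ≤ δ x y + δ y z) (u : ℕ → X) (hu : ∀ x, ∀ ε > 0, ∃ n, δ x (u n) < ε) :
    ∃ A : X → cZeroSp, ∀ x y, δ x y / 10 ≤ ‖A x - A y‖ ∧ ‖A x - A y‖ ≤ δ x y := by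
  classical
  have hnn : ∀ x y, 0 ≤ δ x y := fun x y => by
    have := ht x y x; rw [h0, hs y x] at this; linarith
  -- the functions
  let R : ℤ → ℝ := fun k => (2:ℝ) ^ k
  have hR : ∀ k, 0 < R k := fun k => by positivity
  let g : ℕ → ℤ → X → ℝ := fun n k x =>
    (Finset.range (n+1)).inf' ⟨0, by simp⟩ (fun m => max 0 (δ x (u m) - R k))
  let F : X → ℕ × ℤ → ℝ := fun x i =>
    min (max 0 (3 * R i.2 - δ x (u (i.1+1)))) (g i.1 i.2 x)
  have hg0 : ∀ n k x, 0 ≤ g n k x := fun n k x => by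
    apply Finset.le_inf'; intro m _; exact le_max_left _ _
  have hF0 : ∀ x i, 0 ≤ F x i := fun x i => le_min (le_max_left _ _) (hg0 _ _ _)
  have hgl : ∀ n k x y, g n k x ≤ g n k y + δ x y := by
    intro n k x y
    obtain ⟨m, hm, hme⟩ := Finset.exists_mem_eq_inf' (s := Finset.range (n+1)) ⟨0, by simp⟩
      (fun m => max 0 (δ y (u m) - R k))
    have h1 : g n k x ≤ max 0 (δ x (u m) - R k) := Finset.inf'_le _ hm
    have h2 : g n k y = max 0 (δ y (u m) - R k) := hme
    rw [h2]
    refine h1.trans (max_le ?_ ?_)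
    · have := le_max_left 0 (δ y (u m) - R k); linarith [hnn x y]
    · have := le_max_right 0 (δ y (u m) - R k); linarith [ht x y (u m)]
  have hFl : ∀ i x y, F x i ≤ F y i + δ x y := by
    intro i x y
    show _ ≤ min _ _ + _
    rw [← min_add_add_right]
    refine le_min ((min_le_left _ _).trans ?_) ((min_le_right _ _).trans (hgl _ _ _ _))
    refine max_le ?_ ?_
    · have := le_max_left 0 (3 * R i.2 - δ y (u (i.1+1))); linarith [hnn x y]
    · have := le_max_right 0 (3 * R i.2 - δ y (u (i.1+1)))
      have := ht y x (u (i.1+1)); rw [hs y x] at this; linarith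
  have hFfin : ∀ x, ∀ ε > 0, {i | ε ≤ |F x i|}.Finite := by
    intro x ε hε
    -- bounds on k
    obtain ⟨k0, hk0⟩ : ∃ k0 : ℤ, 3 * R k0 < ε := by
      obtain ⟨n, hn⟩ := exists_pow_lt_of_lt_one (show 0 < ε / 3 by positivity)
        (show (1/2:ℝ) < 1 by norm_num)
      refine ⟨-(n:ℤ), ?_⟩
      have : R (-(n:ℤ)) = (1/2)^n := by simp [R, zpow_neg]
      rw [this]; linarith
    obtain ⟨k1, hk1⟩ : ∃ k1 : ℤ, δ x (u 0) ≤ R k1 := by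
      obtain ⟨n, hn⟩ := pow_unbounded_of_one_lt (δ x (u 0)) (show (1:ℝ) < 2 by norm_num)
      exact ⟨n, by simpa [R] using hn.le⟩
    choose N hN using fun k => hu x (R k) (hR k)
    have hz : ∀ n k m, m ≤ n → δ x (u m) ≤ R k → F x (n, k) = 0 := by
      intro n k m hm hle
      apply le_antisymm _ (hF0 _ _)
      refine (min_le_right _ _).trans ?_
      refine (Finset.inf'_le _ (Finset.mem_range.2 (Nat.lt_succ_of_le hm))).trans ?_
      simp [hle]
    have hsub : {i | ε ≤ |F x i|} ⊆ ⋃ k ∈ Set.Icc k0 k1, (fun n => (n, k)) '' Set.Iic (N k) := by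
      rintro ⟨n, k⟩ hi
      simp only [Set.mem_ofPred_eq, abs_of_nonneg (hF0 _ _)] at hi
      have hk0' : k0 ≤ k := by
        by_contra hlt
        push Not at hlt
        have h1 : R k ≤ R k0 := zpow_le_zpow_right₀ (by norm_num) hlt.le
        have h2 : F x (n,k) ≤ 3 * R k := by
          refine (min_le_left _ _).trans (max_le ?_ ?_)
          · linarith [hR k]
          · simp only; linarith [hnn x (u (n+1))]
        linarith
      have hk1' : k ≤ k1 := by
        by_contra hlt
        push Not at hlt
        have h1 : R k1 ≤ R k := zpow_le_zpow_right₀ (by norm_num) hlt.le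
        rw [hz n k 0 (Nat.zero_le _) (hk1.trans h1)] at hi
        linarith
      have hn : n ≤ N k := by
        by_contra hlt
        push Not at hlt
        rw [hz n k (N k) hlt.le (hN k).le] at hi
        linarith
      simp only [Set.mem_iUnion]
      exact ⟨k, ⟨hk0', hk1'⟩, n, hn, rfl⟩
    refine Set.Finite.subset ?_ hsub
    exact (Set.finite_Icc k0 k1).biUnion fun k _ => (Set.finite_Iic _).image _
  obtain ⟨φ, hφ⟩ := exists_injective_nat (ℕ × ℤ)
  choose A hA1 hA2 using fun x => c0_mk_exists (F x) (hFfin x) φ hφ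
  refine ⟨A, fun x y => ⟨?_, ?_⟩⟩
  · rcases (hnn x y).eq_or_lt with h | h
    · rw [← h]; simp
    -- choose scale
    obtain ⟨k, hk1, hk2⟩ := exists_mem_Ico_zpow (show 0 < δ x y / 5 by positivity)
      (show (1:ℝ) < 2 by norm_num)
    have hk1' : 5 * R k ≤ δ x y := by
      have : R k ≤ δ x y / 5 := hk1
      linarith
    have hk2' : δ x y ≤ 10 * R k := by
      have : R (k+1) = 2 * R k := by
        show (2:ℝ)^(k+1) = 2 * 2^k
        rw [zpow_add_one₀ (by norm_num)]; ring
      have h3 : δ x y / 5 < R (k+1) := hk2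
      linarith
    have key : ∀ a b, 5 * R k ≤ δ a b → 2 * R k < δ a (u 0) → R k ≤ ‖A a - A b‖ := by
      intro a b hab ha0
      have hex : ∃ n, δ a (u n) ≤ 2 * R k := by
        obtain ⟨n, hn⟩ := hu a (2 * R k) (by linarith [hR k])
        exact ⟨n, hn.le⟩
      have hfind := Nat.find_spec hex
      have hmin : ∀ m, m < Nat.find hex → 2 * R k < δ a (u m) := fun m hm =>
        not_le.1 (Nat.find_min hex hm)
      obtain ⟨n, hn⟩ : ∃ n, Nat.find hex = n + 1 := by
        refine Nat.exists_eq_succ_of_ne_zero ?_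
        intro h0
        rw [h0] at hfind; linarith
      rw [hn] at hfind hmin
      have h1 : R k ≤ F a (n, k) := by
        refine le_min (le_max_of_le_right (by simp only; linarith)) ?_
        apply Finset.le_inf'
        intro m hm
        exact le_max_of_le_right (by linarith [hmin m (Finset.mem_range.1 hm)])
      have h2 : F b (n, k) = 0 := by
        apply le_antisymm _ (hF0 _ _)
        refine (min_le_left _ _).trans (max_le le_rfl ?_)
        have := ht a (u (n+1)) b
        rw [hs (u (n+1)) b] at this
        simp only; linarith
      have h3 := c0_le_norm (A a - A b) (φ (n, k))
      have h4 : (A a - A b) (φ (n,k)) = F a (n,k) - F b (n,k) := by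
        rw [ZeroAtInftyContinuousMap.sub_apply, hA1, hA1]
      rw [h4, h2, sub_zero] at h3
      exact h1.trans ((le_abs_self _).trans h3)
    by_cases hx0 : 2 * R k < δ x (u 0)
    · linarith [key x y hk1' hx0]
    · push Not at hx0
      have : 2 * R k < δ y (u 0) := by
        have := ht x (u 0) y
        rw [hs (u 0) y] at this
        linarith [hR k]
      have h5 := key y x (by rw [hs]; exact hk1') this
      rw [norm_sub_rev] at h5
      linarith
  · refine c0_norm_le (hnn x y) fun n => ?_
    rw [ZeroAtInftyContinuousMap.sub_apply]
    by_cases h : n ∈ Set.range φ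
    · obtain ⟨i, rfl⟩ := h
      rw [hA1, hA1, abs_le]
      have h1 := hFl i x y
      have h2 := hFl i y x
      rw [hs y x] at h2
      constructor <;> linarith
    · rw [hA2 x n h, hA2 y n h]; simpa using hnn x y

/-- Snowflaked version for separable metric spaces. -/
theorem aharoni_snow (X : Type*) [PseudoMetricSpace X] [TopologicalSpace.SeparableSpace X]
    [Nonempty X] {α : ℝ} (hα0 : 0 < α) (hα1 : α ≤ 1) :
    ∃ A : X → cZeroSp, Continuous A ∧
      ∀ x y, dist x y ^ α / 10 ≤ ‖A x - A y‖ ∧ ‖A x - A y‖ ≤ dist x y ^ α := by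
  obtain ⟨A, hA⟩ := aharoni (fun x y : X => dist x y ^ α)
    (fun x => by simp [Real.zero_rpow hα0.ne']) (fun x y => by simp only [dist_comm])
    (fun x y z => (Real.rpow_le_rpow dist_nonneg (dist_triangle x y z) hα0.le).trans
      (Real.rpow_add_le_add_rpow dist_nonneg dist_nonneg hα0.le hα1))
    (TopologicalSpace.denseSeq X) (by
      intro x ε hε
      have hd := TopologicalSpace.denseRange_denseSeq X
      obtain ⟨n, hn⟩ := hd.exists_dist_lt x (show 0 < ε ^ (1/α) by positivity)
      refine ⟨n, ?_⟩
      have := Real.rpow_lt_rpow dist_nonneg hn hα0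
      rwa [← Real.rpow_mul hε.le, one_div_mul_cancel hα0.ne', Real.rpow_one] at this)
  refine ⟨A, ?_, hA⟩
  rw [continuous_iff_continuousAt]
  intro x
  rw [ContinuousAt, tendsto_iff_dist_tendsto_zero]
  have h1 : Tendsto (fun y => dist y x ^ α) (𝓝 x) (𝓝 0) := by
    have : ContinuousAt (fun y => dist y x ^ α) x :=
      (continuousAt_id.dist continuousAt_const).rpow_const (Or.inr hα0.le)
    simpa [ContinuousAt, Real.zero_rpow hα0.ne'] using this
  refine squeeze_zero (fun _ => dist_nonneg) (fun y => ?_) h1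
  rw [dist_eq_norm]; exact (hA y x).2

theorem reducible_snow {X : Type*} [NormedAddCommGroup X] [TopologicalSpace.SeparableSpace X]
    [MeasurableSpace X] [BorelSpace X] {p q : ℝ} (hp : 0 < p) (hpq : p ≤ q) :
    BorelReducible (ESum X p) (ESum cZeroSp q) := by
  have hq : 0 < q := hp.trans_le hpq
  obtain ⟨A, hAc, hA⟩ := aharoni_snow X (α := p / q) (by positivity) ((div_le_one hq).2 hpq)
  refine ⟨fun x n => A (x n), ?_, ?_⟩
  · exact measurable_pi_lambda _ fun n => hAc.measurable.comp (measurable_pi_apply n)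
  · intro x y
    have e1 : ∀ n, (dist (x n) (y n) ^ (p/q)) ^ q = ‖x n - y n‖ ^ p := fun n => by
      rw [← Real.rpow_mul dist_nonneg, div_mul_cancel₀ _ hq.ne', dist_eq_norm]
    constructor
    · intro h
      refine Summable.of_nonneg_of_le (fun n => by positivity) (fun n => ?_) h
      rw [← e1]
      exact Real.rpow_le_rpow (norm_nonneg _) (hA _ _).2 hq.le
    · intro h
      have h' := h.mul_left ((10:ℝ)^q)
      refine Summable.of_nonneg_of_le (fun n => by positivity) (fun n => ?_) h'
      rw [← e1, ← Real.mul_rpow (by norm_num) (norm_nonneg _)]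
      refine Real.rpow_le_rpow (by positivity) ?_ hq.le
      have := (hA (x n) (y n)).1
      linarith


theorem c0_into_C : ∃ J : cZeroSp → CunitSp, ∀ a b, ‖J a - J b‖ = ‖a - b‖ := by
  classical
  let β : ℕ → ℝ → ℝ := fun n t => max 0 (1 - |t - (1/2)^n| / ((1/2)^n / 4))
  have hβc : ∀ n, Continuous (β n) := fun n => by
    show Continuous fun t => max 0 (1 - |t - (1/2)^n| / ((1/2)^n / 4))
    fun_prop
  have hβ0 : ∀ n t, 0 ≤ β n t := fun n t => le_max_left _ _
  have hβ1 : ∀ n t, β n t ≤ 1 := fun n t => by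
    refine max_le zero_le_one ?_
    have : 0 ≤ |t - (1/2)^n| / ((1/2)^n / 4) := by positivity
    linarith
  have hβs : ∀ n t, β n t ≠ 0 → |t - (1/2)^n| < (1/2)^n / 4 := by
    intro n t h
    by_contra hlt
    push Not at hlt
    apply h
    refine max_eq_left ?_
    have : 1 ≤ |t - (1/2)^n| / ((1/2)^n / 4) := by
      rw [le_div_iff₀ (by positivity)]; linarith
    linarith
  have hlt : ∀ m n t, m < n → β m t ≠ 0 → β n t ≠ 0 → False := by
    intro m n t hmn h1 h2
    have e1 := abs_lt.1 (hβs m t h1)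
    have e2 := abs_lt.1 (hβs n t h2)
    have : ((1:ℝ)/2)^n ≤ (1/2)^(m+1) := pow_le_pow_of_le_one (by norm_num) (by norm_num) hmn
    rw [pow_succ] at this
    have hpos : (0:ℝ) < (1/2)^m := by positivity
    linarith [e1.1, e2.2]
  have hdisj : ∀ t, ∃ n0, ∀ n, n ≠ n0 → β n t = 0 := by
    intro t
    by_cases h : ∃ n0, β n0 t ≠ 0
    · obtain ⟨n0, hn0⟩ := h
      refine ⟨n0, fun n hn => ?_⟩
      by_contra hb
      rcases lt_or_gt_of_ne hn with h' | h'
      · exact hlt _ _ _ h' hb hn0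
      · exact hlt _ _ _ h' hn0 hb
    · push Not at h
      exact ⟨0, fun n _ => h n⟩
  choose ν hν using hdisj
  let f : cZeroSp → ℝ → ℝ := fun a t => a (ν t) * β (ν t) t
  have hfc : ∀ a, Continuous (f a) := by
    intro a
    refine continuous_of_uniform_approx_of_continuous fun U hU => ?_
    obtain ⟨ε, hε, hεU⟩ := Metric.mem_uniformity_dist.1 hU
    have htend : Tendsto a atTop (𝓝 0) := by
      have := a.zero_at_infty'
      rwa [cocompact_eq_cofinite, Nat.cofinite_eq_atTop] at this
    obtain ⟨N, hN⟩ := Metric.tendsto_atTop.1 htend ε hε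
    refine ⟨fun t => ∑ n ∈ Finset.range N, a n * β n t, ?_, fun t => hεU ?_⟩
    · exact continuous_finsetSum _ fun n _ => continuous_const.mul (hβc n)
    · show dist (f a t) (∑ n ∈ Finset.range N, a n * β n t) < ε
      by_cases h : ν t < N
      · rw [Finset.sum_eq_single (ν t)]
        · simpa [f] using hε
        · intro n _ hn
          rw [hν t n hn, mul_zero]
        · intro h'; exact absurd (Finset.mem_range.2 h) h'
      · rw [Finset.sum_eq_zero]
        · rw [dist_zero_right]
          have h1 := hN (ν t) (not_lt.1 h)
          rw [dist_zero_right] at h1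
          refine lt_of_le_of_lt ?_ h1
          rw [norm_mul, Real.norm_of_nonneg (hβ0 _ _)]
          exact mul_le_of_le_one_right (norm_nonneg _) (hβ1 _ _)
        · intro n hn
          rw [hν t n, mul_zero]
          rintro rfl
          exact h (Finset.mem_range.1 hn)
  refine ⟨fun a => ⟨fun t => f a t, (hfc a).comp continuous_subtype_val⟩, fun a b => ?_⟩
  apply le_antisymm
  · rw [ContinuousMap.norm_le _ (norm_nonneg _)]
    intro t
    show ‖a (ν t) * β (ν t) t - b (ν t) * β (ν t) t‖ ≤ _
    rw [← sub_mul, norm_mul, Real.norm_of_nonneg (hβ0 _ _)]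
    refine (mul_le_of_le_one_right (norm_nonneg _) (hβ1 _ _)).trans ?_
    exact c0_le_norm (a - b) (ν t)
  · refine c0_norm_le (norm_nonneg _) fun n => ?_
    have hmem : ((1:ℝ)/2)^n ∈ Set.Icc (0:ℝ) 1 := ⟨by positivity, pow_le_one₀ (by norm_num) (by norm_num)⟩
    have hb : β n ((1/2)^n) = 1 := by simp [β]
    have hνn : ν ((1/2)^n) = n := by
      by_contra hne
      have := hν ((1/2)^n) n (Ne.symm hne)
      rw [hb] at this; exact one_ne_zero this
    have key := ContinuousMap.norm_coe_le_norm ((⟨fun t => f a t, (hfc a).comp continuous_subtype_val⟩ : CunitSp) - (⟨fun t => f b t, (hfc b).comp continuous_subtype_val⟩ : CunitSp)) ⟨_, hmem⟩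
    refine le_trans (le_of_eq ?_) key
    show |a n - b n| = ‖a (ν _) * β (ν _) _ - b (ν _) * β (ν _) _‖
    simp only [hνn, hb, mul_one, Real.norm_eq_abs]

instance c0_secondCountable : SecondCountableTopology cZeroSp := by
  obtain ⟨J, hJ⟩ := c0_into_C
  have : Isometry J := Isometry.of_dist_eq fun a b => by rw [dist_eq_norm, dist_eq_norm, hJ]
  exact this.isUniformInducing.isInducing.secondCountableTopology

theorem part1 {p : ℝ} (hp : 1 ≤ p) : BorelBireducible (ESum CunitSp p) (ESum cZeroSp p) := by
  refine ⟨reducible_snow (by linarith) le_rfl, ?_⟩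
  obtain ⟨J, hJ⟩ := c0_into_C
  have hi : Isometry J := Isometry.of_dist_eq fun a b => by rw [dist_eq_norm, dist_eq_norm, hJ]
  refine ⟨fun x n => J (x n), ?_, fun x y => ?_⟩
  · exact measurable_pi_lambda _ fun n => hi.continuous.measurable.comp (measurable_pi_apply n)
  · simp only [ESum, hJ]

instance LSp_secondCountable (r : ℝ) [Fact (1 ≤ ENNReal.ofReal r)] :
    SecondCountableTopology (LSp r) := by
  have : Fact (ENNReal.ofReal r ≠ ∞) := ⟨ENNReal.ofReal_ne_top⟩
  infer_instance

theorem part2 {r p : ℝ} [Fact (1 ≤ ENNReal.ofReal r)] (hp : 1 ≤ p) :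
    BorelReducible (ESum (LSp r) p) (ESum cZeroSp p) :=
  reducible_snow (by linarith) le_rfl


/-- A measurable map into a second countable space is continuous on a residual set. -/
theorem exists_residual_continuousOn {Z W : Type*} [TopologicalSpace Z] [MeasurableSpace Z]
    [BorelSpace Z] [TopologicalSpace W] [SecondCountableTopology W] [MeasurableSpace W]
    [OpensMeasurableSpace W] (Φ : Z → W) (hΦ : Measurable Φ) :
    ∃ G ∈ residual Z, ContinuousOn Φ G := by
  have hB := TopologicalSpace.isBasis_countableBasis W
  have hcount := TopologicalSpace.countable_countableBasis W
  have h1 : ∀ b : TopologicalSpace.countableBasis W, ∃ u : Set Z, IsOpen u ∧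
      (Φ ⁻¹' (b : Set W)) =ᶠ[residual Z] u := fun b =>
    (hΦ (hB.isOpen b.2).measurableSet).residualEq_isOpen
  choose U hUo hU using h1
  have : Countable (TopologicalSpace.countableBasis W) := hcount.to_subtype
  have h2 : ∀ᶠ x in residual Z, ∀ b : TopologicalSpace.countableBasis W, (x ∈ Φ ⁻¹' (b : Set W) ↔ x ∈ U b) := by
    rw [eventually_countable_forall]
    intro b
    exact (hU b).mem_iff
  refine ⟨{x | ∀ b : TopologicalSpace.countableBasis W, (x ∈ Φ ⁻¹' (b : Set W) ↔ x ∈ U b)}, h2, ?_⟩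
  intro x hx
  rw [ContinuousWithinAt, (hB.nhds_hasBasis).tendsto_right_iff]
  rintro b ⟨hb, hxb⟩
  have hxU : x ∈ U ⟨b, hb⟩ := (hx ⟨b, hb⟩).1 hxb
  filter_upwards [mem_nhdsWithin_of_mem_nhds ((hUo ⟨b, hb⟩).mem_nhds hxU), self_mem_nhdsWithin]
    with y hy hyG
  exact (hyG ⟨b, hb⟩).2 hy

/-- The product space of finite alphabets. -/
abbrev ZSp : Type := (n : ℕ) → Fin (n + 1)

/-- finite prefixes -/
abbrev PSp (k : ℕ) : Type := (i : Fin k) → Fin (i.1 + 1)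

/-- replace the first `k` coordinates of `x` by `u` -/
def zmod' (k : ℕ) (u : PSp k) (x : ZSp) : ZSp := fun i => if h : i < k then u ⟨i, h⟩ else x i

def zpre (k : ℕ) (x : ZSp) : PSp k := fun i => x i.1

theorem zmod_lt {k : ℕ} (u : PSp k) (x : ZSp) {i : ℕ} (h : i < k) : zmod' k u x i = u ⟨i, h⟩ := by
  simp [zmod', h]

theorem zmod_ge {k : ℕ} (u : PSp k) (x : ZSp) {i : ℕ} (h : k ≤ i) : zmod' k u x i = x i := by
  simp [zmod', not_lt.2 h]

theorem zmod_continuous (k : ℕ) (u : PSp k) : Continuous (zmod' k u) := by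
  refine continuous_pi fun i => ?_
  by_cases h : i < k
  · simp only [zmod', h, dif_pos]; exact continuous_const
  · simp only [zmod', h]; exact continuous_apply i

theorem cyl_nhds {t : ZSp} {U : Set ZSp} (hU : U ∈ 𝓝 t) : ∃ n, PiNat.cylinder t n ⊆ U := by
  obtain ⟨V, ⟨x, n, rfl⟩, hV, hVU⟩ := (PiNat.isTopologicalBasis_cylinders (fun n : ℕ => Fin (n+1))).mem_nhds_iff.1 hU
  exact ⟨n, by rwa [PiNat.mem_cylinder_iff_eq.1 hV]⟩

theorem cyl_nhds_ev {t : ZSp} {U : Set ZSp} (hU : U ∈ 𝓝 t) :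
    ∀ᶠ n in atTop, PiNat.cylinder t n ⊆ U := by
  obtain ⟨n, hn⟩ := cyl_nhds hU
  filter_upwards [eventually_ge_atTop n] with m hm
  exact (PiNat.cylinder_anti t hm).trans hn

theorem dense_block {O : Set ZSp} (hO : IsOpen O) (hd : Dense O) (k : ℕ) :
    ∃ s : ZSp, ∃ k', k < k' ∧ ∀ x : ZSp, (∀ i, k ≤ i → i < k' → x i = s i) → x ∈ O := by
  have h1 : ∀ u : PSp k, Dense (zmod' k u ⁻¹' O) := by
    intro u
    rw [dense_iff_inter_open]
    rintro U hU ⟨y, hy⟩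
    obtain ⟨n, hn⟩ := cyl_nhds (hU.mem_nhds hy)
    obtain ⟨z, hz1, hz2⟩ := hd.inter_open_nonempty _
      (PiNat.isOpen_cylinder _ (zmod' k u y) (max n k)) ⟨_, PiNat.self_mem_cylinder _ _⟩
    rw [PiNat.mem_cylinder_iff] at hz1
    refine ⟨zmod' k (zpre k y) z, hn ?_, ?_⟩
    · rw [PiNat.mem_cylinder_iff]
      intro i hi
      by_cases hik : i < k
      · rw [zmod_lt _ _ hik]; rfl
      · rw [zmod_ge _ _ (not_lt.1 hik), hz1 i (lt_max_of_lt_left hi), zmod_ge _ _ (not_lt.1 hik)]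
    · have : zmod' k u (zmod' k (zpre k y) z) = z := by
        funext i
        by_cases hik : i < k
        · rw [zmod_lt _ _ hik, hz1 i (lt_max_of_lt_right hik), zmod_lt _ _ hik]
        · rw [zmod_ge _ _ (not_lt.1 hik), zmod_ge _ _ (not_lt.1 hik)]
      simpa [this] using hz2
  have h2 : Dense (⋂ u : PSp k, zmod' k u ⁻¹' O) :=
    dense_iInter_of_isOpen (fun u => hO.preimage (zmod_continuous k u)) h1
  obtain ⟨s, hs⟩ := h2.nonempty
  have h3 : IsOpen (⋂ u : PSp k, zmod' k u ⁻¹' O) :=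
    isOpen_iInter_of_finite fun u => hO.preimage (zmod_continuous k u)
  obtain ⟨k', hk'⟩ := cyl_nhds (h3.mem_nhds hs)
  refine ⟨s, max (k+1) k', by omega, fun x hx => ?_⟩
  have h4 : zmod' k (zpre k s) x ∈ PiNat.cylinder s k' := by
    rw [PiNat.mem_cylinder_iff]
    intro i hi
    by_cases hik : i < k
    · rw [zmod_lt _ _ hik]; rfl
    · rw [zmod_ge _ _ (not_lt.1 hik)]
      exact hx i (not_lt.1 hik) (lt_max_of_lt_right hi)
  have h5 := Set.mem_iInter.1 (hk' h4) (zpre k x)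
  have : zmod' k (zpre k x) (zmod' k (zpre k s) x) = x := by
    funext i
    by_cases hik : i < k
    · rw [zmod_lt _ _ hik]; rfl
    · rw [zmod_ge _ _ (not_lt.1 hik), zmod_ge _ _ (not_lt.1 hik)]
  simpa [this] using h5

theorem residual_block {G : Set ZSp} (hG : G ∈ residual ZSp) :
    ∃ t : ZSp, ∃ B : ℕ → ℕ, (∀ a, a < B a) ∧
      ∀ x : ZSp, (∃ᶠ a in atTop, ∀ i, a ≤ i → i < B a → x i = t i) → x ∈ G := by
  obtain ⟨D, hDG, hDδ, hDd⟩ := mem_residual.1 hG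
  obtain ⟨f, hfo, rfl⟩ := hDδ.eq_iInter_nat
  let O : ℕ → Set ZSp := fun j => ⋂ i ∈ Set.Iic j, f i
  have hOo : ∀ j, IsOpen (O j) := fun j => (Set.finite_Iic j).isOpen_biInter fun i _ => hfo i
  have hOd : ∀ j, Dense (O j) := fun j => hDd.mono fun x hx => by
    simp only [O, Set.mem_iInter]; exact fun i _ => Set.mem_iInter.1 hx i
  choose S K hK hS using fun j k => dense_block (hOo j) (hOd j) k
  -- block endpoints
  let κ : ℕ → ℕ := fun j => Nat.rec 0 (fun j k => K j k) j
  have hκs : ∀ j, κ (j+1) = K j (κ j) := fun j => rfl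
  have hκm : StrictMono κ := strictMono_nat_of_lt_succ fun j => by rw [hκs]; exact hK _ _
  let σ : ℕ → ZSp := fun j => Nat.rec (fun _ => 0) (fun j s => zmod' (κ j) (zpre (κ j) s) (S j (κ j))) j
  have hσs : ∀ j, σ (j+1) = zmod' (κ j) (zpre (κ j) (σ j)) (S j (κ j)) := fun j => rfl
  have hσ1 : ∀ j i, i < κ j → σ (j+1) i = σ j i := fun j i h => by
    rw [hσs, zmod_lt _ _ h]; rfl
  have hσ2 : ∀ j m i, i < κ j → j ≤ m → σ m i = σ j i := by
    intro j m i hi hm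
    induction m, hm using Nat.le_induction with
    | base => rfl
    | succ m hm ih => rw [hσ1 m i (hi.trans_le (hκm.monotone hm)), ih]
  let t : ZSp := fun i => σ (i+1) i
  have ht : ∀ j i, κ j ≤ i → i < κ (j+1) → t i = S j (κ j) i := by
    intro j i h1 h2
    have h3 : σ (j+1) i = S j (κ j) i := by rw [hσs, zmod_ge _ _ h1]
    have h4 : i < κ (i+1) := hκm.id_le (i+1)
    rw [← h3]
    rcases le_total (i+1) (j+1) with h | h
    · exact (hσ2 (i+1) (j+1) i h4 h).symm
    · exact hσ2 (j+1) (i+1) i h2 h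
  refine ⟨t, fun a => κ (a+1), fun a => hκm.id_le (a+1), fun x hx => hDG ?_⟩
  rw [Set.mem_iInter]
  intro n
  obtain ⟨a, han, ha⟩ := frequently_atTop.1 hx n
  have : x ∈ O a := by
    refine hS a (κ a) x fun i h1 h2 => ?_
    rw [ha i ((hκm.id_le a).trans h1) h2, ht a i h1 h2]
  simp only [O, Set.mem_iInter] at this
  exact this n han


theorem rpow_add_le_two {a b q : ℝ} (ha : 0 ≤ a) (hb : 0 ≤ b) (hq : 0 ≤ q) :
    (a + b) ^ q ≤ 2 ^ q * (a ^ q + b ^ q) := by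
  have h1 : a + b ≤ 2 * max a b := by
    have := le_max_left a b; have := le_max_right a b; linarith
  refine (Real.rpow_le_rpow (by positivity) h1 hq).trans ?_
  rw [Real.mul_rpow (by norm_num) (le_max_of_le_left ha)]
  gcongr
  rcases max_choice a b with h | h <;> rw [h]
  · have : 0 ≤ b ^ q := by positivity
    linarith
  · have : 0 ≤ a ^ q := by positivity
    linarith

theorem block_tri {Y : Type*} [NormedAddCommGroup Y] {q : ℝ} (hq : 0 ≤ q) (I : Finset ℕ)
    (f g h : ℕ → Y) : ∑ m ∈ I, ‖f m - h m‖ ^ q ≤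
      2 ^ q * (∑ m ∈ I, ‖f m - g m‖ ^ q + ∑ m ∈ I, ‖g m - h m‖ ^ q) := by
  rw [← Finset.sum_add_distrib, Finset.mul_sum]
  refine Finset.sum_le_sum fun m _ => ?_
  refine (Real.rpow_le_rpow (norm_nonneg _) (norm_sub_le_norm_sub_add_norm_sub _ (g m) _) hq).trans ?_
  exact rpow_add_le_two (norm_nonneg _) (norm_nonneg _) hq

theorem summable_blocks {f : ℕ → ℝ} (hf : ∀ m, 0 ≤ f m) {l : ℕ → ℕ} (hl : StrictMono l)
    (h0 : l 0 = 0) : Summable f ↔ Summable fun j => ∑ m ∈ Finset.Ico (l j) (l (j+1)), f m := by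
  have key : ∀ N, ∑ j ∈ Finset.range N, ∑ m ∈ Finset.Ico (l j) (l (j+1)), f m
      = ∑ m ∈ Finset.range (l N), f m := by
    intro N
    induction N with
    | zero => simp [h0]
    | succ N ih =>
      rw [Finset.sum_range_succ, ih, Finset.range_eq_Ico,
        Finset.sum_Ico_consecutive _ (Nat.zero_le _) (hl (Nat.lt_succ_self N)).le]
      rw [Finset.range_eq_Ico]
  constructor
  · intro h
    refine summable_of_sum_range_le (c := ∑' m, f m) (fun j => Finset.sum_nonneg fun m _ => hf m) ?_
    intro N
    rw [key]
    exact h.sum_le_tsum _ fun m _ => hf m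
  · intro h
    refine summable_of_sum_range_le (c := ∑' j, ∑ m ∈ Finset.Ico (l j) (l (j+1)), f m) hf ?_
    intro N
    calc ∑ m ∈ Finset.range N, f m ≤ ∑ m ∈ Finset.range (l N), f m :=
          Finset.sum_le_sum_of_subset_of_nonneg (Finset.range_mono (hl.id_le N)) fun m _ _ => hf m
      _ = _ := (key N).symm
      _ ≤ _ := h.sum_le_tsum _ fun j _ => Finset.sum_nonneg fun m _ => hf m

theorem thmB {Y : Type*} [NormedAddCommGroup Y] [MeasurableSpace Y] [BorelSpace Y]
    [SecondCountableTopology Y] {q : ℝ} (hq : 1 ≤ q) (Θ : ZSp → ℕ → Y) (hΘ : Measurable Θ)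
    (hfin : ∀ x k (u : PSp k), Summable fun m => ‖Θ (zmod' k u x) m - Θ x m‖ ^ q) :
    ∃ (n l : ℕ → ℕ) (t : ZSp), StrictMono n ∧ StrictMono l ∧
      ∀ x y : ZSp, (∀ i, i ∉ Set.range n → x i = t i) → (∀ i, i ∉ Set.range n → y i = t i) →
      ((Summable fun m => ‖Θ x m - Θ y m‖ ^ q) ↔
        Summable fun j => ∑ m ∈ Finset.Ico (l j) (l (j+1)),
          ‖Θ (Function.update t (n j) (x (n j))) m - Θ (Function.update t (n j) (y (n j))) m‖ ^ q) := by
  classical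
  have hq0 : 0 ≤ q := by linarith
  let tail : (Σ k, PSp k) × ℕ → ZSp → ℝ≥0∞ := fun s x =>
    ∑' m, ENNReal.ofReal (‖Θ (zmod' s.1.1 s.1.2 x) (m + s.2) - Θ x (m + s.2)‖ ^ q)
  have hΘm : ∀ m, Measurable fun x => Θ x m := fun m => (measurable_pi_apply m).comp hΘ
  have htail : ∀ s, Measurable (tail s) := by
    intro s
    refine Measurable.tsum fun m => ?_
    refine ENNReal.measurable_ofReal.comp ?_
    have h1 : Measurable fun x => Θ (zmod' s.1.1 s.1.2 x) (m + s.2) :=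
      (hΘm _).comp (zmod_continuous _ _).measurable
    exact ((h1.sub (hΘm _)).norm).pow_const q
  obtain ⟨G, hG, hGc⟩ := exists_residual_continuousOn
    (fun x : ZSp => ((fun m => Θ x m, fun s => tail s x) : (ℕ → Y) × ((Σ k, PSp k) × ℕ → ℝ≥0∞)))
    ((measurable_pi_lambda _ hΘm).prodMk (measurable_pi_lambda _ htail))
  have hGΘ : ∀ m, ContinuousOn (fun x => Θ x m) G := fun m =>
    ((continuous_apply m).comp continuous_fst).comp_continuousOn hGc
  have hGt : ∀ s, ContinuousOn (tail s) G := fun s =>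
    ((continuous_apply s).comp continuous_snd).comp_continuousOn hGc
  obtain ⟨t, B, hB, htB⟩ := residual_block hG
  have htu : ∀ k (u : PSp k), zmod' k u t ∈ G := by
    intro k u
    refine htB _ (Eventually.frequently ?_)
    filter_upwards [eventually_ge_atTop k] with a ha i hi _
    exact zmod_ge _ _ (ha.trans hi)
  have htG : t ∈ G := htB _ (Eventually.frequently (Eventually.of_forall fun a i _ _ => rfl))
  -- one step of the construction
  have step : ∀ (j : ℕ) (s : ℕ × ℕ), ∃ s' : ℕ × ℕ, s.1 < s'.1 ∧ s.2 < s'.2 ∧ B (s.1+1) ≤ s'.1 ∧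
      (∀ y ∈ G, y ∈ PiNat.cylinder t s'.1 → ∀ u : PSp (s.1+1),
        tail (⟨s.1+1, u⟩, s'.2) y ≤ ENNReal.ofReal ((1/2)^j)) ∧
      (∀ u : PSp (s.1+1), ∀ x ∈ G, x ∈ PiNat.cylinder (zmod' (s.1+1) u t) s'.1 →
        ∑ m ∈ Finset.range s'.2, ‖Θ x m - Θ (zmod' (s.1+1) u t) m‖ ^ q ≤ (1/2)^j) := by
    rintro j ⟨n, l⟩
    have hεpos : (0:ℝ) < (1/2)^j := by positivity
    have hl : ∀ᶠ l' in atTop, ∀ u : PSp (n+1), tail (⟨n+1, u⟩, l') t < ENNReal.ofReal ((1/2)^j) := by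
      rw [eventually_all]
      intro u
      have hne : ∑' m, ENNReal.ofReal (‖Θ (zmod' (n+1) u t) m - Θ t m‖ ^ q) ≠ ∞ := by
        rw [← ENNReal.ofReal_tsum_of_nonneg (fun m => by positivity) (hfin t (n+1) u)]
        exact ENNReal.ofReal_ne_top
      have := ENNReal.tendsto_sum_nat_add _ hne
      exact this.eventually (gt_mem_nhds (by simpa using hεpos))
    obtain ⟨l', hl'1, hl'2⟩ := (hl.and (eventually_gt_atTop l)).exists
    have ha : ∀ᶠ n' in atTop, ∀ u : PSp (n+1), ∀ y ∈ G, y ∈ PiNat.cylinder t n' →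
        tail (⟨n+1, u⟩, l') y ≤ ENNReal.ofReal ((1/2)^j) := by
      rw [eventually_all]
      intro u
      have h1 := (hGt (⟨n+1, u⟩, l') t htG).eventually (gt_mem_nhds (hl'1 u))
      rw [eventually_nhdsWithin_iff] at h1
      filter_upwards [cyl_nhds_ev h1] with n' hn' y hy hyc
      exact (hn' hyc hy).le
    have hb : ∀ᶠ n' in atTop, ∀ u : PSp (n+1), ∀ x ∈ G, x ∈ PiNat.cylinder (zmod' (n+1) u t) n' →
        ∑ m ∈ Finset.range l', ‖Θ x m - Θ (zmod' (n+1) u t) m‖ ^ q ≤ (1/2)^j := by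
      rw [eventually_all]
      intro u
      have h0 : ContinuousWithinAt (fun x => ∑ m ∈ Finset.range l',
          ‖Θ x m - Θ (zmod' (n+1) u t) m‖ ^ q) G (zmod' (n+1) u t) := by
        refine tendsto_finsetSum _ fun m _ => ?_
        have := ((hGΘ m (zmod' (n+1) u t) (htu _ u)).sub
          (continuousWithinAt_const (b := Θ (zmod' (n+1) u t) m))).norm
        exact this.rpow_const (Or.inr hq0)
      have h1 := h0.eventually (gt_mem_nhds (show (∑ m ∈ Finset.range l',
          ‖Θ (zmod' (n+1) u t) m - Θ (zmod' (n+1) u t) m‖ ^ q) < (1/2:ℝ)^j by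
        simp [Real.zero_rpow (show q ≠ 0 by linarith)]))
      rw [eventually_nhdsWithin_iff] at h1
      filter_upwards [cyl_nhds_ev h1] with n' hn' y hy hyc
      exact (hn' hyc hy).le
    obtain ⟨n', h1, h2, h3, h4⟩ := (ha.and (hb.and ((eventually_gt_atTop n).and
      (eventually_ge_atTop (B (n+1)))))).exists
    exact ⟨(n', l'), h3, hl'2, h4, fun y hy hyc u => h1 u y hy hyc, h2⟩
  choose F hF1 hF2 hF3 hF4 hF5 using step
  let st : ℕ → ℕ × ℕ := fun j => Nat.rec (0, 0) (fun j s => F j s) j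
  have hst : ∀ j, st (j+1) = F j (st j) := fun j => rfl
  let n : ℕ → ℕ := fun j => (st j).1
  let l : ℕ → ℕ := fun j => (st j).2
  have hn : StrictMono n := strictMono_nat_of_lt_succ fun j => hF1 j (st j)
  have hl : StrictMono l := strictMono_nat_of_lt_succ fun j => hF2 j (st j)
  have hl0 : l 0 = 0 := rfl
  have hnB : ∀ j, B (n j + 1) ≤ n (j+1) := fun j => hF3 j (st j)
  have hA : ∀ j, ∀ y ∈ G, y ∈ PiNat.cylinder t (n (j+1)) → ∀ u : PSp (n j + 1),
        tail (⟨n j + 1, u⟩, l (j+1)) y ≤ ENNReal.ofReal ((1/2)^j) := fun j => hF4 j (st j)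
  have hBb : ∀ j, ∀ u : PSp (n j +1), ∀ x ∈ G, x ∈ PiNat.cylinder (zmod' (n j+1) u t) (n (j+1)) →
        ∑ m ∈ Finset.range (l (j+1)), ‖Θ x m - Θ (zmod' (n j+1) u t) m‖ ^ q ≤ (1/2)^j :=
    fun j => hF5 j (st j)
  clear_value st
  have hbetween : ∀ j i, n j < i → i < n (j+1) → i ∉ Set.range n := by
    rintro j i h1 h2 ⟨k, rfl⟩
    have := hn.lt_iff_lt.1 h1
    have := hn.lt_iff_lt.1 h2
    omega
  have hXG : ∀ x : ZSp, (∀ i, i ∉ Set.range n → x i = t i) → x ∈ G := by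
    intro x hx
    refine htB x (frequently_atTop.2 fun a => ⟨n a + 1, (hn.id_le a).trans (Nat.le_succ _), ?_⟩)
    intro i h1 h2
    exact hx i (hbetween a i h1 (h2.trans_le (hnB a)))
  -- approximation of blocks
  have approx : ∀ x : ZSp, (∀ i, i ∉ Set.range n → x i = t i) → 
      Summable fun j => ∑ m ∈ Finset.Ico (l j) (l (j+1)),
        ‖Θ x m - Θ (Function.update t (n j) (x (n j))) m‖ ^ q := by
    intro x hx
    have hsum : Summable fun j : ℕ => 2 ^ q * (2 * (1/2:ℝ)^j + (1/2)^j) :=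
      ((summable_geometric_two.mul_left 2).add summable_geometric_two).mul_left _
    refine Summable.of_nonneg_of_le (fun j => Finset.sum_nonneg fun m _ => by positivity)
      (fun j => ?_) hsum
    let w : ZSp := zmod' (n j) (zpre (n j) t) x
    have hwX : ∀ i, i ∉ Set.range n → w i = t i := by
      intro i hi
      by_cases h : i < n j
      · show zmod' _ _ _ _ = _
        rw [zmod_lt _ _ h]; rfl
      · show zmod' _ _ _ _ = _
        rw [zmod_ge _ _ (not_lt.1 h)]; exact hx i hi
    have hwlt : ∀ i, i < n j → w i = t i := fun i h => by
      show zmod' _ _ _ _ = _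
      rw [zmod_lt _ _ h]; rfl
    have hwge : ∀ i, n j ≤ i → w i = x i := fun i h => by
      show zmod' _ _ _ _ = _
      rw [zmod_ge _ _ h]
    refine (block_tri hq0 _ (Θ x) (Θ w) _).trans ?_
    gcongr
    · -- x versus w
      rcases j with _ | j
      · have : x = w := by
          funext i
          by_cases h : i < n 0
          · rw [hwlt i h]
            apply hx
            rintro ⟨k, rfl⟩
            exact absurd (hn.monotone (Nat.zero_le k)) (not_le.2 h)
          · rw [hwge i (not_lt.1 h)]
        rw [← this]
        simp [Real.zero_rpow (show q ≠ 0 by linarith)]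
      · have h1 := hA j w (hXG w hwX) (by
          rw [PiNat.mem_cylinder_iff]; exact hwlt) (zpre (n j + 1) x)
        have h2 : zmod' (n j + 1) (zpre (n j + 1) x) w = x := by
          funext i
          by_cases h : i < n j + 1
          · rw [zmod_lt _ _ h]; rfl
          · rw [zmod_ge _ _ (not_lt.1 h)]
            by_cases h' : i < n (j+1)
            · have hi := hbetween j i (by omega) h'
              rw [hwX i hi, hx i hi]
            · exact hwge i (not_lt.1 h')
        have h3 : ∑ m ∈ Finset.range (l (j+1+1) - l (j+1)),
            ENNReal.ofReal (‖Θ x (m + l (j+1)) - Θ w (m + l (j+1))‖ ^ q) ≤ ENNReal.ofReal ((1/2)^j) := by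
          refine (ENNReal.sum_le_tsum _).trans ?_
          simpa only [tail, h2] using h1
        rw [← ENNReal.ofReal_sum_of_nonneg (fun m _ => by positivity),
          ENNReal.ofReal_le_ofReal_iff (by positivity)] at h3
        rw [Finset.sum_Ico_eq_sum_range]
        simp only [add_comm (l (j+1))]
        refine h3.trans (le_of_eq ?_)
        rw [pow_succ]; ring
    · -- w versus z
      let z : ZSp := Function.update t (n j) (x (n j))
      have hz : zmod' (n j + 1) (zpre (n j + 1) z) t = z := by
        funext i
        by_cases h : i < n j + 1
        · rw [zmod_lt _ _ h]; rfl
        · rw [zmod_ge _ _ (not_lt.1 h)]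
          show _ = Function.update t (n j) (x (n j)) i
          rw [Function.update_of_ne (by omega)]
      have h1 := hBb j (zpre (n j + 1) z) w (hXG w hwX) (by
        rw [hz, PiNat.mem_cylinder_iff]
        intro i hi
        show w i = Function.update t (n j) (x (n j)) i
        rcases lt_trichotomy i (n j) with h | h | h
        · rw [hwlt i h, Function.update_of_ne (by omega)]
        · subst h
          rw [hwge _ le_rfl, Function.update_self]
        · rw [Function.update_of_ne (by omega)]
          exact hwX i (hbetween j i h hi))
      rw [hz] at h1
      refine le_trans ?_ h1
      refine Finset.sum_le_sum_of_subset_of_nonneg ?_ fun m _ _ => by positivity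
      intro m hm
      rw [Finset.mem_Ico] at hm
      exact Finset.mem_range.2 hm.2
  refine ⟨n, l, t, hn, hl, fun x y hx hy => ?_⟩
  rw [summable_blocks (fun m => by positivity) hl hl0]
  have hDx := approx x hx
  have hDy := approx y hy
  have hDx' : Summable fun j => ∑ m ∈ Finset.Ico (l j) (l (j+1)),
        ‖Θ (Function.update t (n j) (x (n j))) m - Θ x m‖ ^ q := by
    simpa only [norm_sub_rev] using hDx
  have hDy' : Summable fun j => ∑ m ∈ Finset.Ico (l j) (l (j+1)),
        ‖Θ (Function.update t (n j) (y (n j))) m - Θ y m‖ ^ q := by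
    simpa only [norm_sub_rev] using hDy
  constructor
  · intro h
    refine Summable.of_nonneg_of_le (fun j => Finset.sum_nonneg fun m _ => by positivity)
      (fun j => ?_) ((hDx'.add ((h.add hDy).mul_left (2^q))).mul_left (2^q))
    refine (block_tri hq0 _ _ (Θ x) _).trans ?_
    gcongr
    exact block_tri hq0 _ _ (Θ y) _
  · intro h
    refine Summable.of_nonneg_of_le (fun j => Finset.sum_nonneg fun m _ => by positivity)
      (fun j => ?_) ((hDx.add ((h.add hDy').mul_left (2^q))).mul_left (2^q))
    refine (block_tri hq0 _ _ (Θ (Function.update t (n j) (x (n j)))) _).trans ?_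
    gcongr
    exact block_tri hq0 _ _ (Θ (Function.update t (n j) (y (n j)))) _


theorem thmC1 {X Y : Type*} [NormedAddCommGroup X] [MeasurableSpace X]
    [NormedAddCommGroup Y] [MeasurableSpace Y] [BorelSpace Y]
    [SecondCountableTopology Y] {p q : ℝ} (hp : 1 ≤ p) (hq : 1 ≤ q)
    (hred : BorelReducible (ESum X p) (ESum Y q)) (e : ℕ → X) :
    ∃ (l : ℕ → ℕ) (τ : ℕ → ℕ → ℕ → Y), ∀ x y : ℕ → ℕ, (∀ j, x j ≤ j) → (∀ j, y j ≤ j) →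
      ((Summable fun j => ‖e (x j) - e (y j)‖ ^ p) ↔
        Summable fun j => ∑ m ∈ Finset.Ico (l j) (l (j+1)), ‖τ j (x j) m - τ j (y j) m‖ ^ q) := by
  classical
  obtain ⟨θ, hθ, hred⟩ := hred
  have hp0 : p ≠ 0 := by linarith
  let Θ : ZSp → ℕ → Y := fun z => θ fun n => e (z n)
  have hΘ : Measurable Θ := by
    refine hθ.comp (measurable_pi_lambda _ fun n => ?_)
    exact (measurable_from_top (f := fun a : Fin (n+1) => e a)).comp (measurable_pi_apply n)
  have hfin : ∀ x k (u : PSp k), Summable fun m => ‖Θ (zmod' k u x) m - Θ x m‖ ^ q := by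
    intro x k u
    refine (hred (fun n => e (zmod' k u x n)) (fun n => e (x n))).1 ?_
    refine summable_of_ne_finset_zero (s := Finset.range k) fun i hi => ?_
    beta_reduce
    rw [zmod_ge _ _ (by simpa using hi)]
    simp [Real.zero_rpow hp0]
  obtain ⟨n, l, t, hn, hl, H⟩ := thmB hq Θ hΘ hfin
  refine ⟨l, fun j a => Θ (Function.update t (n j) (Fin.ofNat (n j + 1) a)), fun x y hx hy => ?_⟩
  let lift : (ℕ → ℕ) → ZSp := fun x i =>
    if i ∈ Set.range n then Fin.ofNat (i+1) (x (Function.invFun n i)) else t i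
  have l1 : ∀ x i, i ∉ Set.range n → lift x i = t i := fun x i hi => by simp only [lift, if_neg hi]
  have l2 : ∀ x j, lift x (n j) = Fin.ofNat (n j + 1) (x j) := fun x j => by
    simp only [lift, if_pos (Set.mem_range_self j)]
    rw [Function.leftInverse_invFun hn.injective j]
  have l3 : ∀ x : ℕ → ℕ, (∀ j, x j ≤ j) → ∀ j, (lift x (n j) : ℕ) = x j := fun x hx j => by
    rw [l2]
    show x j % (n j + 1) = x j
    exact Nat.mod_eq_of_lt (Nat.lt_succ_of_le ((hx j).trans (hn.id_le j)))
  have h1 := H (lift x) (lift y) (l1 x) (l1 y)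
  simp only [l2] at h1
  rw [← h1]
  refine Iff.trans ?_ (hred (fun i => e (lift x i)) (fun i => e (lift y i)))
  have h2 := hn.injective.summable_iff (f := fun i => ‖e (lift x i) - e (lift y i)‖ ^ p) (by
    intro i hi
    rw [l1 x i hi, l1 y i hi]
    simp [Real.zero_rpow hp0])
  refine Iff.trans (Eq.to_iff (congrArg Summable ?_)) h2
  funext j
  simp only [Function.comp, l3 x hx, l3 y hy]

/-- The diagonal selection lemma. -/
theorem diag_select (A B : ℕ → ℕ → ℕ → ℝ) (hA : ∀ j a b, 0 ≤ A j a b) (hB : ∀ j a b, 0 ≤ B j a b)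
    (hA0 : ∀ j a, A j a a = 0) (hB0 : ∀ j a, B j a a = 0)
    (H : ∀ k : ℕ, ∃ a b : ℕ, ∃ w : ℝ, 0 < w ∧ w ≤ 1 ∧
      ∃ᶠ j in atTop, A j a b ≤ (1/2)^k * w ∧ w ≤ B j a b) :
    ∃ x y : ℕ → ℕ, (∀ j, x j ≤ j) ∧ (∀ j, y j ≤ j) ∧ (Summable fun j => A j (x j) (y j)) ∧
      ¬ Summable fun j => B j (x j) (y j) := by
  classical
  choose a b w hw0 hw1 hf using H
  let N : ℕ → ℕ := fun k => ⌈1 / w k⌉₊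
  have hN1 : ∀ k, 1 ≤ N k * w k := fun k => by
    have := Nat.le_ceil (1 / w k)
    rw [div_le_iff₀ (hw0 k)] at this
    exact this
  have hN2 : ∀ k, N k * w k ≤ 2 := fun k => by
    have := (Nat.ceil_lt_add_one (a := 1 / w k) (by have := hw0 k; positivity)).le
    have h2 := mul_le_mul_of_nonneg_right this (hw0 k).le
    rw [add_mul, div_mul_cancel₀ _ (hw0 k).ne'] at h2
    have := hw1 k
    exact h2.trans (by linarith)
  have hNpos : ∀ k, 0 < N k := fun k => Nat.ceil_pos.2 (by have := hw0 k; positivity)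
  let S := Σ k, Fin (N k)
  have : Infinite S := by
    refine Infinite.of_injective (fun k : ℕ => (⟨k, ⟨0, hNpos k⟩⟩ : S)) fun k k' h => ?_
    exact congrArg Sigma.fst h
  obtain ⟨E⟩ : Nonempty (ℕ ≃ S) := nonempty_equiv_of_countable
  obtain ⟨φ, hφ, hφ2⟩ := extraction_forall_of_frequently
    (P := fun i j => (A j (a (E i).1) (b (E i).1) ≤ (1/2)^((E i).1) * w (E i).1 ∧
      w (E i).1 ≤ B j (a (E i).1) (b (E i).1)) ∧ max (a (E i).1) (b (E i).1) ≤ j)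
    (fun i => (hf (E i).1).and_eventually (eventually_ge_atTop _))
  let sel : (ℕ → ℕ) → ℕ → ℕ := fun c j =>
    if j ∈ Set.range φ then c (E (Function.invFun φ j)).1 else 0
  have s1 : ∀ c j, j ∉ Set.range φ → sel c j = 0 := fun c j hj => by simp only [sel, if_neg hj]
  have s2 : ∀ c i, sel c (φ i) = c (E i).1 := fun c i => by
    simp only [sel, if_pos (Set.mem_range_self i)]
    rw [Function.leftInverse_invFun hφ.injective i]
  refine ⟨sel a, sel b, ?_, ?_, ?_, ?_⟩
  · intro j
    by_cases hj : j ∈ Set.range φ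
    · obtain ⟨i, rfl⟩ := hj
      rw [s2]; exact (le_max_left _ _).trans (hφ2 i).2
    · rw [s1 _ _ hj]; exact Nat.zero_le _
  · intro j
    by_cases hj : j ∈ Set.range φ
    · obtain ⟨i, rfl⟩ := hj
      rw [s2]; exact (le_max_right _ _).trans (hφ2 i).2
    · rw [s1 _ _ hj]; exact Nat.zero_le _
  · rw [← hφ.injective.summable_iff (fun j hj => by rw [s1 _ _ hj, s1 _ _ hj, hA0])]
    have hs : Summable fun s : S => (1/2:ℝ)^s.1 * w s.1 := by
      rw [summable_sigma_of_nonneg (fun s => by have := hw0 s.1; positivity)]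
      refine ⟨fun k => (hasSum_fintype _).summable, ?_⟩
      refine Summable.of_nonneg_of_le (fun k => tsum_nonneg fun s => by have := hw0 k; positivity)
        (fun k => ?_) (summable_geometric_two.mul_left 2)
      rw [tsum_fintype]
      simp only [Finset.sum_const, Finset.card_univ, Fintype.card_fin, nsmul_eq_mul]
      have := hN2 k
      have h3 : (0:ℝ) < (1/2)^k := by positivity
      calc (N k : ℝ) * ((1/2)^k * w k) = (N k * w k) * (1/2)^k := by ring
        _ ≤ 2 * (1/2)^k := by gcongr
    refine Summable.of_nonneg_of_le (fun i => hA _ _ _) (fun i => ?_) (E.summable_iff.2 hs)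
    simp only [Function.comp, s2]
    exact (hφ2 i).1.1
  · rw [← hφ.injective.summable_iff (fun j hj => by rw [s1 _ _ hj, s1 _ _ hj, hB0])]
    intro hsB
    have hs : Summable fun s : S => w s.1 := by
      rw [← E.summable_iff]
      refine Summable.of_nonneg_of_le (fun i => (hw0 _).le) (fun i => ?_) hsB
      simp only [Function.comp, s2]
      exact (hφ2 i).1.2
    rw [summable_sigma_of_nonneg (fun s => (hw0 _).le)] at hs
    have h4 := hs.2.tendsto_atTop_zero
    have h5 := ge_of_tendsto h4 (b := (1:ℝ)) (Eventually.of_forall fun k => by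
      rw [tsum_fintype]
      simp only [Finset.sum_const, Finset.card_univ, Fintype.card_fin, nsmul_eq_mul]
      exact hN1 k)
    linarith

theorem thmC {X Y : Type*} [NormedAddCommGroup X] [MeasurableSpace X]
    [NormedAddCommGroup Y] [MeasurableSpace Y] [BorelSpace Y]
    [SecondCountableTopology Y] {p q : ℝ} (hp : 1 ≤ p) (hq : 1 ≤ q)
    (hred : BorelReducible (ESum X p) (ESum Y q)) (e : ℕ → X) :
    ∃ c C η : ℝ, 0 < c ∧ 0 < C ∧ 0 < η ∧ ∀ S : Finset ℕ,
      (∀ a ∈ S, ∀ b ∈ S, ‖e a - e b‖ ^ p < η) →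
      ∃ (I : Finset ℕ) (τ : ℕ → ℕ → Y), ∀ a ∈ S, ∀ b ∈ S, e a ≠ e b →
        c * ‖e a - e b‖ ^ p ≤ ∑ m ∈ I, ‖τ a m - τ b m‖ ^ q ∧
        ∑ m ∈ I, ‖τ a m - τ b m‖ ^ q ≤ C * ‖e a - e b‖ ^ p := by
  obtain ⟨l, τ, H⟩ := thmC1 hp hq hred e
  have hp0 : p ≠ 0 := by linarith
  have hq0 : q ≠ 0 := by linarith
  let D : ℕ → ℕ → ℕ → ℝ := fun _ a b => ‖e a - e b‖ ^ p
  let Δ : ℕ → ℕ → ℕ → ℝ := fun j a b =>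
    ∑ m ∈ Finset.Ico (l j) (l (j+1)), ‖τ j a m - τ j b m‖ ^ q
  have hD : ∀ j a b, 0 ≤ D j a b := fun j a b => by positivity
  have hΔ : ∀ j a b, 0 ≤ Δ j a b := fun j a b => Finset.sum_nonneg fun m _ => by positivity
  have hD0 : ∀ j a, D j a a = 0 := fun j a => by simp [D, Real.zero_rpow hp0]
  have hΔ0 : ∀ j a, Δ j a a = 0 := fun j a => by simp [Δ, Real.zero_rpow hq0]
  have U : ∃ k : ℕ, ∀ a b, e a ≠ e b → ‖e a - e b‖ ^ p < (1/4)^k →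
      ∀ᶠ j in atTop, Δ j a b < 2 ^ k * ‖e a - e b‖ ^ p := by
    by_contra! hcon
    obtain ⟨x, y, hx, hy, h1, h2⟩ := diag_select D Δ hD hΔ hD0 hΔ0 (fun k => by
      obtain ⟨a, b, hab, hlt, hf⟩ := hcon k
      have hpos : 0 < ‖e a - e b‖ ^ p := Real.rpow_pos_of_pos (norm_pos_iff.2 (sub_ne_zero.2 hab)) _
      refine ⟨a, b, 2^k * ‖e a - e b‖ ^ p, by positivity, ?_, ?_⟩
      · calc 2^k * ‖e a - e b‖ ^ p ≤ 2^k * (1/4)^k := by gcongr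
          _ = (1/2)^k := by rw [← mul_pow]; norm_num
          _ ≤ 1 := pow_le_one₀ (by norm_num) (by norm_num)
      · refine hf.mono fun j hj => ⟨le_of_eq ?_, hj⟩
        rw [← mul_assoc, ← mul_pow]; norm_num [D])
    exact h2 ((H x y hx hy).1 h1)
  have Lo : ∃ k : ℕ, ∀ a b, e a ≠ e b → ‖e a - e b‖ ^ p < 1 →
      ∀ᶠ j in atTop, (1/2)^k * ‖e a - e b‖ ^ p < Δ j a b := by
    by_contra! hcon
    obtain ⟨x, y, hx, hy, h1, h2⟩ := diag_select Δ D hΔ hD hΔ0 hD0 (fun k => by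
      obtain ⟨a, b, hab, hlt, hf⟩ := hcon k
      have hpos : 0 < ‖e a - e b‖ ^ p := Real.rpow_pos_of_pos (norm_pos_iff.2 (sub_ne_zero.2 hab)) _
      exact ⟨a, b, ‖e a - e b‖ ^ p, hpos, hlt.le, hf.mono fun j hj => ⟨hj, le_rfl⟩⟩)
    exact h2 ((H x y hx hy).2 h1)
  obtain ⟨k, hk⟩ := U
  obtain ⟨k', hk'⟩ := Lo
  refine ⟨(1/2)^k', 2^k, (1/4)^k, by positivity, by positivity, by positivity, fun S hS => ?_⟩
  have h : ∀ᶠ j in atTop, ∀ a ∈ S, ∀ b ∈ S, e a ≠ e b →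
      (1/2)^k' * ‖e a - e b‖ ^ p ≤ Δ j a b ∧ Δ j a b ≤ 2^k * ‖e a - e b‖ ^ p := by
    rw [Filter.eventually_all_finset]
    intro a ha
    rw [Filter.eventually_all_finset]
    intro b hb
    by_cases hab : e a = e b
    · exact Eventually.of_forall fun j h => absurd hab h
    · have h1 := hS a ha b hb
      filter_upwards [hk a b hab h1, hk' a b hab (h1.trans_le (pow_le_one₀ (by norm_num) (by norm_num)))]
        with j h2 h3 _
      exact ⟨h3.le, h2.le⟩
  obtain ⟨j, hj⟩ := h.exists
  exact ⟨_, τ j, hj⟩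


theorem thmC' {X Y ι : Type*} [Countable ι] [Nonempty ι] [NormedAddCommGroup X] [MeasurableSpace X]
    [NormedAddCommGroup Y] [MeasurableSpace Y] [BorelSpace Y]
    [SecondCountableTopology Y] {p q : ℝ} (hp : 1 ≤ p) (hq : 1 ≤ q)
    (hred : BorelReducible (ESum X p) (ESum Y q)) (e : ι → X) :
    ∃ c C η : ℝ, 0 < c ∧ 0 < C ∧ 0 < η ∧ ∀ S : Finset ι,
      (∀ a ∈ S, ∀ b ∈ S, ‖e a - e b‖ ^ p < η) →
      ∃ (I : Finset ℕ) (τ : ι → ℕ → Y), ∀ a ∈ S, ∀ b ∈ S, e a ≠ e b →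
        c * ‖e a - e b‖ ^ p ≤ ∑ m ∈ I, ‖τ a m - τ b m‖ ^ q ∧
        ∑ m ∈ I, ‖τ a m - τ b m‖ ^ q ≤ C * ‖e a - e b‖ ^ p := by
  classical
  obtain ⟨f, hf⟩ := exists_surjective_nat ι
  obtain ⟨g, hg⟩ := hf.hasRightInverse
  obtain ⟨c, C, η, hc, hC, hη, H⟩ := thmC hp hq hred (e ∘ f)
  refine ⟨c, C, η, hc, hC, hη, fun S hS => ?_⟩
  obtain ⟨I, τ, hI⟩ := H (S.image g) (by
    intro a ha b hb
    obtain ⟨a, ha', rfl⟩ := Finset.mem_image.1 ha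
    obtain ⟨b, hb', rfl⟩ := Finset.mem_image.1 hb
    simpa [hg a, hg b] using hS a ha' b hb')
  refine ⟨I, fun a => τ (g a), fun a ha b hb hab => ?_⟩
  have := hI (g a) (Finset.mem_image_of_mem _ ha) (g b) (Finset.mem_image_of_mem _ hb)
    (by simpa [hg a, hg b] using hab)
  simpa [hg a, hg b] using this

theorem thmD {X Y ι : Type*} [Countable ι] [Nonempty ι] [NormedAddCommGroup X] [NormedSpace ℝ X]
    [MeasurableSpace X]
    [NormedAddCommGroup Y] [NormedSpace ℝ Y] [MeasurableSpace Y] [BorelSpace Y]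
    [SecondCountableTopology Y] {p q : ℝ} (hp : 1 ≤ p) (hq : 1 ≤ q)
    (hred : BorelReducible (ESum X p) (ESum Y q)) (e : ι → X) :
    ∃ c C : ℝ, 0 < c ∧ 0 < C ∧ ∀ S : Finset ι,
      ∃ (I : Finset ℕ) (τ : ι → ℕ → Y), ∀ a ∈ S, ∀ b ∈ S, e a ≠ e b →
        c * ‖e a - e b‖ ^ p ≤ ∑ m ∈ I, ‖τ a m - τ b m‖ ^ q ∧
        ∑ m ∈ I, ‖τ a m - τ b m‖ ^ q ≤ C * ‖e a - e b‖ ^ p := by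
  classical
  obtain ⟨c, C, η, hc, hC, hη, H⟩ := thmC' hp hq hred (fun x : ι × ℕ => (1/2:ℝ)^x.2 • e x.1)
  refine ⟨c, C, hc, hC, fun S => ?_⟩
  have hlim : ∀ a b, Tendsto (fun s : ℕ => ‖(1/2:ℝ)^s • e a - (1/2:ℝ)^s • e b‖ ^ p) atTop (𝓝 0) := by
    intro a b
    have h1 : Tendsto (fun s : ℕ => (1/2:ℝ)^s) atTop (𝓝 0) :=
      tendsto_pow_atTop_nhds_zero_of_lt_one (by norm_num) (by norm_num)
    have h2 := (((h1.smul_const (e a)).sub (h1.smul_const (e b))).norm).rpow_const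
      (p := p) (Or.inr (by linarith))
    simpa [Real.zero_rpow (show p ≠ 0 by linarith)] using h2
  have hev : ∀ᶠ s : ℕ in atTop, ∀ a ∈ S, ∀ b ∈ S,
      ‖(1/2:ℝ)^s • e a - (1/2:ℝ)^s • e b‖ ^ p < η := by
    rw [Filter.eventually_all_finset]
    intro a _
    rw [Filter.eventually_all_finset]
    intro b _
    exact (hlim a b).eventually (gt_mem_nhds hη)
  obtain ⟨s, hs⟩ := hev.exists
  have hsp : (0:ℝ) < (1/2)^s := by positivity
  obtain ⟨I, τ, hI⟩ := H (S.image fun a => (a, s)) (by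
    intro a ha b hb
    obtain ⟨a, ha', rfl⟩ := Finset.mem_image.1 ha
    obtain ⟨b, hb', rfl⟩ := Finset.mem_image.1 hb
    exact hs a ha' b hb')
  set L : ℝ := (1/2)^s with hL
  refine ⟨I, fun a m => (L ^ (-(p/q))) • τ (a, s) m, fun a ha b hb hab => ?_⟩
  have h1 := hI (a, s) (Finset.mem_image_of_mem _ ha) (b, s) (Finset.mem_image_of_mem _ hb) (by
    simpa [← hL, (hsp.ne')] using hab)
  simp only [← hL] at h1
  have e1 : ‖L • e a - L • e b‖ ^ p = L ^ p * ‖e a - e b‖ ^ p := by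
    rw [← smul_sub, norm_smul, Real.mul_rpow (norm_nonneg _) (norm_nonneg _), Real.norm_of_nonneg hsp.le]
  have e2 : ∑ m ∈ I, ‖L ^ (-(p/q)) • τ (a, s) m - L ^ (-(p/q)) • τ (b, s) m‖ ^ q
      = (L ^ p)⁻¹ * ∑ m ∈ I, ‖τ (a, s) m - τ (b, s) m‖ ^ q := by
    rw [Finset.mul_sum]
    refine Finset.sum_congr rfl fun m _ => ?_
    rw [← smul_sub, norm_smul, Real.mul_rpow (norm_nonneg _) (norm_nonneg _),
      Real.norm_of_nonneg (by positivity), ← Real.rpow_mul hsp.le, ← Real.rpow_neg hsp.le]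
    congr 2
    field_simp
  rw [e1] at h1
  have hLp : 0 < L ^ p := by positivity
  rw [e2]
  rw [le_inv_mul_iff₀ hLp, inv_mul_le_iff₀ hLp]
  exact ⟨by linarith [h1.1], by linarith [h1.2]⟩

theorem part4b {p q : ℝ} (hp : 1 ≤ p) (hpq : p < q) :
    ¬ BorelReducible (ESum cZeroSp q) (ESum cZeroSp p) := by
  classical
  intro hred
  obtain ⟨u, hu⟩ : ∃ u : cZeroSp, ‖u‖ = 1 := by
    have hnt : Nontrivial cZeroSp := by
      obtain ⟨A, -, hA⟩ := aharoni_snow ℝ (α := 1) one_pos le_rfl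
      refine ⟨A 0, A 1, fun h => ?_⟩
      have := (hA 0 1).1
      rw [h] at this
      norm_num at this
    obtain ⟨u, hu⟩ := exists_ne (0 : cZeroSp)
    exact ⟨(‖u‖⁻¹ : ℝ) • u, by rw [norm_smul, norm_inv, norm_norm, inv_mul_cancel₀ (norm_ne_zero_iff.2 hu)]⟩
  obtain ⟨c, C, hc, hC, H⟩ := thmD (by linarith) hp hred (fun x : ℚ => (x:ℝ) • u)
  have hnorm : ∀ x y : ℚ, ‖(x:ℝ) • u - (y:ℝ) • u‖ = |(x:ℝ) - y| := fun x y => by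
    have h0 : (x:ℝ) • u - (y:ℝ) • u = ((x:ℝ) - y) • u := (sub_smul _ _ _).symm
    rw [h0, norm_smul, hu, mul_one, Real.norm_eq_abs]
  have hne : ∀ x y : ℚ, x ≠ y → (x:ℝ) • u ≠ (y:ℝ) • u := fun x y hxy h => by
    have := hnorm x y
    rw [h, sub_self, norm_zero] at this
    have h2 : (x:ℝ) = y := by
      have := abs_eq_zero.1 this.symm; linarith
    exact hxy (by exact_mod_cast h2)
  have key : ∀ m : ℕ, 0 < m → c ≤ C * (m:ℝ) ^ (p - q) := by
    intro m hm
    have hm' : (0:ℝ) < m := by exact_mod_cast hm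
    obtain ⟨I, τ, hI⟩ := H ((Finset.range (m+1)).image fun w : ℕ => (w:ℚ)/m)
    have hmem : ∀ w : ℕ, w ≤ m → (w:ℚ)/m ∈ (Finset.range (m+1)).image fun w : ℕ => (w:ℚ)/m := fun w hw =>
      Finset.mem_image_of_mem _ (Finset.mem_range.2 (by omega))
    have hmQ : (m:ℚ) ≠ 0 := by positivity
    have h1 := (hI _ (hmem m le_rfl) _ (hmem 0 (Nat.zero_le _)) (hne _ _ (by simp [hmQ]))).1
    rw [hnorm] at h1
    have h2 : ∀ w < m, ∑ i ∈ I, ‖τ (((w+1:ℕ):ℚ)/m) i - τ ((w:ℚ)/m) i‖ ^ p ≤ C * ((m:ℝ)⁻¹) ^ q := by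
      intro w hw
      have := (hI _ (hmem (w+1) hw) _ (hmem w hw.le) (hne _ _ (by
        intro h; field_simp at h; push_cast at h; linarith))).2
      rw [hnorm] at this
      refine this.trans (le_of_eq ?_)
      congr 2
      push_cast
      rw [← sub_div, add_sub_cancel_left, one_div, abs_of_pos (by positivity)]
    have h3 : ∀ i, ‖τ ((m:ℚ)/m) i - τ (((0:ℕ):ℚ)/m) i‖ ^ p ≤
        (m:ℝ)^(p-1) * ∑ w ∈ Finset.range m, ‖τ (((w+1:ℕ):ℚ)/m) i - τ ((w:ℚ)/m) i‖ ^ p := by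
      intro i
      have h4 := Real.rpow_sum_le_const_mul_sum_rpow (Finset.range m)
        (fun w => ‖τ (((w+1:ℕ):ℚ)/m) i - τ ((w:ℚ)/m) i‖) hp
      simp only [abs_norm, Finset.card_range] at h4
      refine le_trans (Real.rpow_le_rpow (norm_nonneg _) ?_ (by linarith)) h4
      rw [← Finset.sum_range_sub (fun w : ℕ => τ ((w:ℚ)/m) i) m]
      exact norm_sum_le _ _
    have h5 : ∑ i ∈ I, ‖τ ((m:ℚ)/m) i - τ (((0:ℕ):ℚ)/m) i‖ ^ p ≤
        (m:ℝ)^(p-1) * (m * (C * ((m:ℝ)⁻¹) ^ q)) := by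
      refine (Finset.sum_le_sum fun i _ => h3 i).trans ?_
      rw [← Finset.mul_sum, Finset.sum_comm]
      gcongr
      refine (Finset.sum_le_sum fun w hw => h2 w (Finset.mem_range.1 hw)).trans ?_
      simp
    have h6 : (m:ℝ)^(p-1) * (m * (C * ((m:ℝ)⁻¹) ^ q)) = C * (m:ℝ)^(p-q) := by
      rw [Real.inv_rpow hm'.le, ← Real.rpow_neg hm'.le]
      have : (m:ℝ)^(p-q) = (m:ℝ)^(p-1) * (m:ℝ)^(1:ℝ) * (m:ℝ)^(-q) := by
        rw [← Real.rpow_add hm', ← Real.rpow_add hm']; congr 1; ring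
      rw [this, Real.rpow_one]; ring
    rw [h6] at h5
    refine le_trans ?_ (h1.trans h5)
    push_cast
    rw [div_self hm'.ne']
    simp
  have hl : Tendsto (fun m : ℕ => C * (m:ℝ) ^ (p - q)) atTop (𝓝 (C * 0)) := by
    have := (tendsto_rpow_neg_atTop (show 0 < q - p by linarith)).comp tendsto_natCast_atTop_atTop
    rw [neg_sub] at this
    exact this.const_mul C
  have := ge_of_tendsto hl ((eventually_gt_atTop 0).mono key)
  linarith


/-- Kernels on a set which are finite sums of squares (positive semidefinite kernels). -/
def PKer {V : Type} (M : V → V → ℝ) : Prop :=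
  ∃ (ι : Type) (_ : Fintype ι) (B : ι → V → ℝ), ∀ x y, M x y = ∑ z, B z x * B z y

theorem PKer.add {V : Type} {M N : V → V → ℝ} (hM : PKer M) (hN : PKer N) :
    PKer fun x y => M x y + N x y := by
  obtain ⟨ι, _, B, hB⟩ := hM
  obtain ⟨κ, _, D, hD⟩ := hN
  refine ⟨ι ⊕ κ, inferInstance, Sum.elim B D, fun x y => ?_⟩
  simp [hB, hD]

theorem PKer.mul {V : Type} {M N : V → V → ℝ} (hM : PKer M) (hN : PKer N) :
    PKer fun x y => M x y * N x y := by
  obtain ⟨ι, _, B, hB⟩ := hM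
  obtain ⟨κ, _, D, hD⟩ := hN
  refine ⟨ι × κ, inferInstance, fun z x => B z.1 x * D z.2 x, fun x y => ?_⟩
  beta_reduce
  rw [hB, hD, Finset.sum_mul_sum, Fintype.sum_prod_type]
  refine Finset.sum_congr rfl fun i _ => Finset.sum_congr rfl fun j _ => ?_
  ring

theorem PKer.const {V : Type} {c : ℝ} (hc : 0 ≤ c) : PKer fun _ _ : V => c := by
  refine ⟨Unit, inferInstance, fun _ _ => Real.sqrt c, fun x y => ?_⟩
  simp [Real.mul_self_sqrt hc]

theorem PKer.comap {V U : Type} {M : V → V → ℝ} (hM : PKer M) (φ : U → V) :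
    PKer fun x y => M (φ x) (φ y) := by
  obtain ⟨ι, _, B, hB⟩ := hM
  exact ⟨ι, inferInstance, fun z x => B z (φ x), fun x y => hB _ _⟩

theorem PKer.prod {V ι : Type} (s : Finset ι) {M : ι → V → V → ℝ} (hM : ∀ i, PKer (M i)) :
    PKer fun x y => ∏ i ∈ s, M i x y := by
  classical
  induction s using Finset.induction_on with
  | empty => simpa using PKer.const (V := V) zero_le_one
  | insert a s ha ih =>
    simp only [Finset.prod_insert ha]
    exact (hM a).mul ih

theorem PKer.prod_sub {V ι : Type} (s : Finset ι) {M N : ι → V → V → ℝ} (hM : ∀ i, PKer (M i))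
    (hN : ∀ i, PKer (N i))
    (hMN : ∀ i, PKer fun x y => N i x y - M i x y) :
    PKer fun x y => ∏ i ∈ s, N i x y - ∏ i ∈ s, M i x y := by
  classical
  induction s using Finset.induction_on with
  | empty => simpa using PKer.const (V := V) le_rfl
  | insert a s ha ih =>
    simp only [Finset.prod_insert ha]
    have := ((hN a).mul ih).add ((hMN a).mul (PKer.prod s hM))
    convert this using 3
    ring

theorem PKer.inner_nonneg {V : Type} [Fintype V] {M : V → V → ℝ} (hM : PKer M)
    {H : Type*} [NormedAddCommGroup H] [InnerProductSpace ℝ H] (f : V → H) :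
    0 ≤ ∑ x, ∑ y, M x y * inner ℝ (f x) (f y) := by
  obtain ⟨ι, _, B, hB⟩ := hM
  have : ∑ x, ∑ y, M x y * inner ℝ (f x) (f y) =
      ∑ z, inner ℝ (∑ x, B z x • f x) (∑ y, B z y • f y) := by
    have h1 : ∀ z, inner ℝ (∑ x, B z x • f x) (∑ y, B z y • f y) =
        ∑ x, ∑ y, B z x * B z y * inner ℝ (f x) (f y) := by
      intro z
      rw [sum_inner (𝕜 := ℝ)]
      refine Finset.sum_congr rfl fun x _ => ?_
      rw [inner_sum (𝕜 := ℝ)]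
      refine Finset.sum_congr rfl fun y _ => ?_
      rw [real_inner_smul_left, real_inner_smul_right]; ring
    simp only [h1]
    symm
    rw [Finset.sum_comm]
    refine Finset.sum_congr rfl fun x _ => ?_
    rw [Finset.sum_comm]
    refine Finset.sum_congr rfl fun y _ => ?_
    rw [hB x y, Finset.sum_mul]
  rw [this]
  exact Finset.sum_nonneg fun z _ => real_inner_self_nonneg

theorem energy_le {V : Type} [Fintype V] {M N : V → V → ℝ}
    (hMN : PKer fun x y => N x y - M x y)
    (hM1 : ∀ x, ∑ y, M x y = 1) (hN1 : ∀ x, ∑ y, N x y = 1)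
    (hMs : ∀ x y, M x y = M y x) (hNs : ∀ x y, N x y = N y x)
    {H : Type*} [NormedAddCommGroup H] [InnerProductSpace ℝ H] (f : V → H) :
    ∑ x, ∑ y, N x y * ‖f x - f y‖ ^ 2 ≤ ∑ x, ∑ y, M x y * ‖f x - f y‖ ^ 2 := by
  have key : ∀ W : V → V → ℝ, (∀ x, ∑ y, W x y = 1) → (∀ x y, W x y = W y x) →
      ∑ x, ∑ y, W x y * ‖f x - f y‖ ^ 2 =
        2 * ∑ x, ‖f x‖ ^ 2 - 2 * ∑ x, ∑ y, W x y * inner ℝ (f x) (f y) := by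
    intro W h1 hs
    have e1 : ∑ x, ∑ y, W x y * ‖f x‖ ^ 2 = ∑ x, ‖f x‖ ^ 2 := by
      refine Finset.sum_congr rfl fun x _ => ?_
      rw [← Finset.sum_mul, h1, one_mul]
    have e2 : ∑ x, ∑ y, W x y * ‖f y‖ ^ 2 = ∑ x, ‖f x‖ ^ 2 := by
      rw [Finset.sum_comm, ← e1]
      simp only [fun x y => hs y x]
    calc _ = ∑ x, ∑ y, (W x y * ‖f x‖ ^ 2 + W x y * ‖f y‖ ^ 2 - 2 * (W x y * inner ℝ (f x) (f y))) := by
          refine Finset.sum_congr rfl fun x _ => Finset.sum_congr rfl fun y _ => ?_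
          rw [norm_sub_sq_real]; ring
      _ = _ := by
          simp only [Finset.sum_sub_distrib, Finset.sum_add_distrib, e1, e2, ← Finset.mul_sum]
          ring
  rw [key M hM1 hMs, key N hN1 hNs]
  have := hMN.inner_nonneg f
  simp only [sub_mul, Finset.sum_sub_distrib] at this
  linarith

section kernel

variable {G : Type} [AddCommGroup G] [Fintype G] [DecidableEq G]

def kdel (x y : G) : ℝ := if x = y then 1 else 0

def kstep (p : ℝ) (h x y : G) : ℝ := (1 - p) * kdel x y + p * ((kdel (x + h) y + kdel (x - h) y) / 2)

theorem kdel_sum (x : G) (F : G → ℝ) : ∑ z, kdel x z * F z = F x := by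
  simp [kdel]

theorem kdel_comm (x y : G) : kdel x y = kdel y x := by
  simp [kdel, eq_comm]

theorem kdel_add (x y h : G) : kdel (x + h) y = kdel x (y - h) := by
  simp [kdel, eq_sub_iff_add_eq]

theorem kdel_sub (x y h : G) : kdel (x - h) y = kdel x (y + h) := by
  simp [kdel, sub_eq_iff_eq_add]

theorem kstep_comm (p : ℝ) (h x y : G) : kstep p h x y = kstep p h y x := by
  simp only [kstep]
  rw [kdel_comm x y, kdel_add, kdel_sub, kdel_comm x, kdel_comm x]
  ring

theorem kstep_sum (p : ℝ) (h x : G) (F : G → ℝ) :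
    ∑ z, kstep p h x z * F z = (1 - p) * F x + p * ((F (x + h) + F (x - h)) / 2) := by
  have : ∀ z, kstep p h x z * F z = (1 - p) * (kdel x z * F z) +
    (p / 2) * (kdel (x+h) z * F z) + (p / 2) * (kdel (x-h) z * F z) := fun z => by
    rw [kstep]; ring
  simp only [this, Finset.sum_add_distrib, ← Finset.mul_sum, kdel_sum]
  ring

theorem kstep_sum_one (p : ℝ) (h x : G) : ∑ z, kstep p h x z = 1 := by
  have := kstep_sum p h x (fun _ => 1)
  simp only [mul_one] at this
  rw [this]; ring

theorem kstep_sq (p : ℝ) (h x y : G) : ∑ z, kstep p h z x * kstep p h z y =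
    (1-p)^2 * kdel x y + (1-p) * p * (kdel (x+h) y + kdel (x-h) y) +
      p^2 / 4 * (kdel (x+h+h) y + kdel (x-h-h) y + 2 * kdel x y) := by
  simp only [fun z => kstep_comm p h z x]
  rw [kstep_sum]
  simp only [kstep, add_sub_cancel_right, sub_add_cancel]
  ring

theorem kdel_pker : PKer (kdel : G → G → ℝ) :=
  ⟨G, inferInstance, kdel, fun x y => by
    simp only [fun z => kdel_comm z x]
    rw [kdel_sum]⟩

theorem kstep_pker {p : ℝ} (hp0 : 0 ≤ p) (hp : p ≤ 1/2) (h : G) : PKer (kstep p h) := by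
  have h1 : PKer fun x y : G => 2 * kdel x y + kdel (x+h) y + kdel (x-h) y := by
    refine ⟨G, inferInstance, fun z x => kdel z x + kdel (z + h) x, fun x y => ?_⟩
    have : ∀ z, (kdel z x + kdel (z+h) x) * (kdel z y + kdel (z+h) y) =
      kdel x z * (kdel z y + kdel (z+h) y) + kdel (x - h) z * (kdel z y + kdel (z+h) y) := fun z => by
      rw [kdel_comm z x, kdel_sub x, kdel_comm x (z+h)]; ring
    simp only [this, Finset.sum_add_distrib, kdel_sum, sub_add_cancel]
    ring
  have := ((PKer.const (V := G) (show 0 ≤ 1 - 2 * p by linarith)).mul kdel_pker).add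
    ((PKer.const (V := G) (show 0 ≤ p / 2 by linarith)).mul h1)
  convert this using 1
  funext x y
  simp only [kstep]; ring

theorem kstep_diff {p : ℝ} (hp0 : 0 ≤ p) (h : G) :
    PKer fun x y => kstep (p/4) (h + h) x y - kstep p h x y := by
  have h1 : PKer fun x y : G => (1-(-1))^2 * kdel x y + (1-(-1)) * (-1) * (kdel (x+h) y + kdel (x-h) y) +
      (-1)^2 / 4 * (kdel (x+h+h) y + kdel (x-h-h) y + 2 * kdel x y)
      - 3 * kdel x y + (kdel (x+h) y + kdel (x-h) y) := by
    refine ⟨G, inferInstance, fun z x => kdel z x - (kdel (z+h) x + kdel (z-h) x)/2, fun x y => ?_⟩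
    have e : ∀ z x : G, kdel z x - (kdel (z+h) x + kdel (z-h) x)/2 = kstep (-1) h z x - kdel z x := by
      intro z x; simp only [kstep]; ring
    have e2 : ∀ z, (kstep (-1) h z x - kdel z x) * (kstep (-1) h z y - kdel z y) =
        kstep (-1) h z x * kstep (-1) h z y - kdel x z * kstep (-1) h z y
          - kdel y z * kstep (-1) h z x + kdel x z * kdel z y := by
      intro z; rw [kdel_comm z x, kdel_comm y z]; ring
    simp only [e, e2, Finset.sum_add_distrib, Finset.sum_sub_distrib, kstep_sq, kdel_sum]
    rw [kstep_comm _ _ y x]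
    simp only [kstep]
    ring
  have := (PKer.const (V := G) (show 0 ≤ p / 2 by linarith)).mul h1
  convert this using 1
  funext x y
  simp only [kstep, add_assoc, sub_sub]; ring

theorem kstep_tele (h : G) (K : ℕ) :
    PKer fun x y => kstep ((1/2) / 4 ^ K) (2 ^ K • h) x y - kstep (1/2) h x y := by
  induction K with
  | zero => simpa using PKer.const (V := G) le_rfl
  | succ K ih =>
    have h1 := kstep_diff (p := (1/2) / 4 ^ K) (by positivity) (2 ^ K • h)
    have h2 := h1.add ih
    convert h2 using 1
    funext x y
    rw [← two_nsmul, smul_smul, div_div (1/2:ℝ) (4^K) 4, ← pow_succ, ← pow_succ']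
    ring

theorem kernel_ineq {n : ℕ} (K : ℕ) (h : G)
    {H : Type*} [NormedAddCommGroup H] [InnerProductSpace ℝ H] (f : (Fin n → G) → H) :
    ∑ x, ∑ y, (∏ i, kstep ((1/2) / 4 ^ K) (2 ^ K • h) (x i) (y i)) * ‖f x - f y‖ ^ 2 ≤
    ∑ x, ∑ y, (∏ i, kstep (1/2) h (x i) (y i)) * ‖f x - f y‖ ^ 2 := by
  refine energy_le ?_ ?_ ?_ ?_ ?_ f
  · refine PKer.prod_sub _ (fun i => ?_) (fun i => ?_) (fun i => ?_)
    · exact (kstep_pker (by norm_num) le_rfl h).comap (fun x : Fin n → G => x i)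
    · refine (kstep_pker (by positivity) ?_ _).comap (fun x : Fin n → G => x i)
      exact div_le_self (by norm_num) (one_le_pow₀ (by norm_num))
    · exact (kstep_tele h K).comap (fun x : Fin n → G => x i)
  · intro x
    have := Finset.prod_univ_sum (fun _ : Fin n => (Finset.univ : Finset G))
      (fun i y => kstep (1/2) h (x i) y)
    simp only [kstep_sum_one, Finset.prod_const_one, Fintype.piFinset_univ] at this
    exact this.symm
  · intro x
    have := Finset.prod_univ_sum (fun _ : Fin n => (Finset.univ : Finset G))
      (fun i y => kstep ((1/2) / 4 ^ K) (2 ^ K • h) (x i) y)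
    simp only [kstep_sum_one, Finset.prod_const_one, Fintype.piFinset_univ] at this
    exact this.symm
  · intro x y; exact Finset.prod_congr rfl fun i _ => kstep_comm _ _ _ _
  · intro x y; exact Finset.prod_congr rfl fun i _ => kstep_comm _ _ _ _

end kernel


/-- homogeneous uniform continuity of `g` relative to `f` -/
def HUC {T Z W : Type*} [NormedAddCommGroup Z] [NormedAddCommGroup W] (f : T → Z) (g : T → W) : Prop :=
  ∀ ε : ℝ, 0 < ε → ∃ δ : ℝ, 0 < δ ∧ ∀ x y, ‖f x - f y‖ ≤ δ * (‖f x‖ + ‖f y‖) →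
    ‖g x - g y‖ ≤ ε * (‖g x‖ + ‖g y‖)

theorem HUC.trans {T Z W U : Type*} [NormedAddCommGroup Z] [NormedAddCommGroup W]
    [NormedAddCommGroup U] {f : T → Z} {g : T → W} {h : T → U} (h1 : HUC f g) (h2 : HUC g h) :
    HUC f h := by
  intro ε hε
  obtain ⟨δ, hδ, H⟩ := h2 ε hε
  obtain ⟨δ', hδ', H'⟩ := h1 δ hδ
  exact ⟨δ', hδ', fun x y hxy => H x y (H' x y hxy)⟩

theorem HUC.comp {T S Z W : Type*} [NormedAddCommGroup Z] [NormedAddCommGroup W]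
    {f : T → Z} {g : T → W} (h1 : HUC f g) (k : S → T) :
    HUC (f ∘ k) (g ∘ k) := by
  intro ε hε
  obtain ⟨δ, hδ, H⟩ := h1 ε hε
  exact ⟨δ, hδ, fun x y hxy => H (k x) (k y) hxy⟩

theorem HUC.ineq {T Z W : Type*} [NormedAddCommGroup Z] [NormedAddCommGroup W]
    {f : T → Z} {g : T → W} (h : HUC f g) {s t : ℝ} (hs : 0 < s) (ht : 0 < t)
    (hn : ∀ x, ‖g x‖ ^ s = ‖f x‖ ^ t) (ε : ℝ) (hε : 0 < ε) :
    ∃ C : ℝ, 0 < C ∧ ∀ x y, ‖g x - g y‖ ^ s ≤ ε * (‖f x‖ ^ t + ‖f y‖ ^ t) + C * ‖f x - f y‖ ^ t := by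
  obtain ⟨δ, hδ, H⟩ := h ((ε / 2 ^ s) ^ (1/s)) (by positivity)
  refine ⟨2 ^ s * (2 * δ⁻¹ ^ t), by positivity, fun x y => ?_⟩
  by_cases hxy : ‖f x - f y‖ ≤ δ * (‖f x‖ + ‖f y‖)
  · have h1 := Real.rpow_le_rpow (norm_nonneg _) (H x y hxy) hs.le
    rw [Real.mul_rpow (by positivity) (by positivity), ← Real.rpow_mul (by positivity),
      one_div, inv_mul_cancel₀ hs.ne', Real.rpow_one] at h1
    have h2 := rpow_add_le_two (norm_nonneg (g x)) (norm_nonneg (g y)) hs.le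
    rw [hn, hn] at h2
    have h3 : ε / 2 ^ s * (‖g x‖ + ‖g y‖) ^ s ≤ ε * (‖f x‖ ^ t + ‖f y‖ ^ t) := by
      calc _ ≤ ε / 2 ^ s * (2 ^ s * (‖f x‖ ^ t + ‖f y‖ ^ t)) := by gcongr
        _ = _ := by field_simp
    have : 0 ≤ 2 ^ s * (2 * δ⁻¹ ^ t) * ‖f x - f y‖ ^ t := by positivity
    linarith
  · push Not at hxy
    have h1 : ∀ z : Z, ‖z‖ ≤ ‖f x‖ + ‖f y‖ → ‖z‖ ^ t ≤ δ⁻¹ ^ t * ‖f x - f y‖ ^ t := by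
      intro z hz
      rw [← Real.mul_rpow (by positivity) (by positivity)]
      refine Real.rpow_le_rpow (norm_nonneg z) ?_ ht.le
      rw [le_inv_mul_iff₀ hδ]
      exact (mul_le_mul_of_nonneg_left hz hδ.le).trans hxy.le
    have hx := h1 (f x) (by linarith [norm_nonneg (f y)])
    have hy := h1 (f y) (by linarith [norm_nonneg (f x)])
    have h2 := Real.rpow_le_rpow (norm_nonneg _) (norm_sub_le (g x) (g y)) hs.le
    have h3 := rpow_add_le_two (norm_nonneg (g x)) (norm_nonneg (g y)) hs.le
    rw [hn, hn] at h3
    have h4 : 0 ≤ ε * (‖f x‖ ^ t + ‖f y‖ ^ t) := by positivity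
    calc ‖g x - g y‖ ^ s ≤ 2 ^ s * (‖f x‖ ^ t + ‖f y‖ ^ t) := h2.trans h3
      _ ≤ 2 ^ s * (δ⁻¹ ^ t * ‖f x - f y‖ ^ t + δ⁻¹ ^ t * ‖f x - f y‖ ^ t) := by gcongr
      _ = 2 ^ s * (2 * δ⁻¹ ^ t) * ‖f x - f y‖ ^ t := by ring
      _ ≤ _ := by linarith

theorem HUC.of_ineq {T Z W : Type*} [NormedAddCommGroup Z] [NormedAddCommGroup W]
    {f : T → Z} {g : T → W} {s t : ℝ} (hs : 0 < s) (ht : 0 < t)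
    (hn : ∀ x, ‖g x‖ ^ s = ‖f x‖ ^ t)
    (H : ∀ ε : ℝ, 0 < ε → ∃ C : ℝ, 0 < C ∧
      ∀ x y, ‖g x - g y‖ ^ s ≤ ε * (‖f x‖ ^ t + ‖f y‖ ^ t) + C * ‖f x - f y‖ ^ t) : HUC f g := by
  intro ε hε
  obtain ⟨C, hC, hC'⟩ := H (ε ^ s / 4) (by positivity)
  refine ⟨(ε ^ s / 4 / C / 2 ^ t) ^ (1/t), by positivity, fun x y hxy => ?_⟩
  have h1 := Real.rpow_le_rpow (norm_nonneg _) hxy ht.le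
  rw [Real.mul_rpow (by positivity) (by positivity), ← Real.rpow_mul (by positivity),
      one_div, inv_mul_cancel₀ ht.ne', Real.rpow_one] at h1
  have h2 := rpow_add_le_two (norm_nonneg (f x)) (norm_nonneg (f y)) ht.le
  have h3 : C * ‖f x - f y‖ ^ t ≤ ε ^ s / 4 * (‖f x‖ ^ t + ‖f y‖ ^ t) := by
    calc _ ≤ C * (ε ^ s / 4 / C / 2 ^ t * (2 ^ t * (‖f x‖ ^ t + ‖f y‖ ^ t))) := by
          gcongr; exact h1.trans (by gcongr)
      _ = _ := by field_simp
  have h4 := hC' x y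
  have h5 : ‖f x‖ ^ t ≤ (‖g x‖ + ‖g y‖) ^ s := by
    rw [← hn]
    exact Real.rpow_le_rpow (norm_nonneg _) (by linarith [norm_nonneg (g y)]) hs.le
  have h6 : ‖f y‖ ^ t ≤ (‖g x‖ + ‖g y‖) ^ s := by
    rw [← hn]
    exact Real.rpow_le_rpow (norm_nonneg _) (by linarith [norm_nonneg (g x)]) hs.le
  have h7 : ‖g x - g y‖ ^ s ≤ (ε * (‖g x‖ + ‖g y‖)) ^ s := by
    rw [Real.mul_rpow hε.le (by positivity)]
    have : 0 < ε ^ s := by positivity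
    nlinarith
  exact (Real.rpow_le_rpow_iff (norm_nonneg _) (by positivity) hs).1 h7

/-- radial power map -/
def radial {E : Type*} [NormedAddCommGroup E] [NormedSpace ℝ E] (β : ℝ) (z : E) : E :=
  ‖z‖ ^ (β - 1) • z

section radial
variable {E : Type*} [NormedAddCommGroup E] [NormedSpace ℝ E]

theorem rpow_sub_one_mul {a β : ℝ} (ha : 0 ≤ a) (hβ : 0 < β) : a ^ (β - 1) * a = a ^ β := by
  rcases ha.eq_or_lt with rfl | h
  · rw [mul_zero, Real.zero_rpow hβ.ne']
  · rw [Real.rpow_sub_one h.ne', div_mul_cancel₀ _ h.ne']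

theorem norm_radial {β : ℝ} (hβ : 0 < β) (z : E) : ‖radial β z‖ = ‖z‖ ^ β := by
  rw [radial, norm_smul, Real.norm_of_nonneg (by positivity), rpow_sub_one_mul (norm_nonneg _) hβ]

theorem radial_inv {β : ℝ} (hβ : 0 < β) (z : E) : radial β⁻¹ (radial β z) = z := by
  by_cases hz : z = 0
  · simp [radial, hz]
  have h0 : 0 < ‖z‖ := norm_pos_iff.2 hz
  rw [radial, norm_radial hβ, radial, smul_smul, ← Real.rpow_mul h0.le, ← Real.rpow_add h0]
  rw [show β * (β⁻¹ - 1) + (β - 1) = 0 by field_simp; ring, Real.rpow_zero, one_smul]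

theorem radial_HUC {β : ℝ} (hβ : 0 < β) : HUC (fun z : E => z) (fun z : E => radial β z) := by
  intro ε hε
  have hc : Tendsto (fun t : ℝ => |t - t ^ β|) (𝓝 1) (𝓝 0) := by
    have : ContinuousAt (fun t : ℝ => |t - t ^ β|) 1 :=
      (continuousAt_id.sub (Real.continuousAt_rpow_const 1 β (Or.inl one_ne_zero))).abs
    have h := this.tendsto
    simpa using h
  obtain ⟨δ, hδ, H⟩ := Metric.eventually_nhds_iff.1 (hc.eventually (gt_mem_nhds (half_pos hε)))
  have main : ∀ z w : E, ‖w‖ ≤ ‖z‖ → ‖z - w‖ ≤ min (δ/4) (ε/4) * (‖z‖ + ‖w‖) →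
      ‖radial β z - radial β w‖ ≤ ε * (‖radial β z‖ + ‖radial β w‖) := by
    intro z w hwz h
    rcases (norm_nonneg z).eq_or_lt with h0 | h0
    · have hz : z = 0 := norm_eq_zero.1 h0.symm
      have hw : w = 0 := norm_eq_zero.1 (le_antisymm (by linarith) (norm_nonneg _))
      subst hz; subst hw
      simp; positivity
    set a := ‖z‖ with ha
    set b := ‖w‖ with hb
    have hb0 : 0 ≤ b := norm_nonneg w
    have h1 : ‖z - w‖ ≤ min (δ/4) (ε/4) * (2 * a) := h.trans (by gcongr; linarith)
    have h2 : ‖z - w‖ ≤ δ / 2 * a := h1.trans (by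
      have := min_le_left (δ/4) (ε/4); nlinarith)
    have h3 : ‖z - w‖ ≤ ε / 2 * a := h1.trans (by
      have := min_le_right (δ/4) (ε/4); nlinarith)
    have h4 : a - b ≤ ‖z - w‖ := norm_sub_norm_le z w
    have h5 : |b/a - (b/a) ^ β| < ε / 2 := by
      apply H
      rw [Real.dist_eq, abs_sub_comm, abs_of_nonneg (by
        rw [sub_nonneg, div_le_one h0]; exact hwz)]
      rw [sub_lt_iff_lt_add, ← sub_lt_iff_lt_add', lt_div_iff₀ h0]
      nlinarith
    have h6 : radial β z - radial β w = a ^ (β-1) • (z - w) + (a ^ (β-1) - b ^ (β-1)) • w := by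
      simp only [radial, ← ha, ← hb, smul_sub, sub_smul]; abel
    have h7 : ‖(a ^ (β-1) - b ^ (β-1)) • w‖ ≤ a ^ β * (ε / 2) := by
      rw [norm_smul, ← hb, Real.norm_eq_abs]
      have e1 : |a ^ (β-1) - b ^ (β-1)| * b = a ^ β * |b/a - (b/a)^β| := by
        rw [← abs_of_nonneg hb0, ← abs_mul, abs_of_nonneg hb0,
          ← abs_of_nonneg (show 0 ≤ a ^ β by positivity), ← abs_mul]
        congr 1
        rw [sub_mul, rpow_sub_one_mul hb0 hβ, mul_sub, Real.div_rpow hb0 h0.le, Real.rpow_sub_one h0.ne']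
        have : a ^ β ≠ 0 := by positivity
        field_simp
      rw [e1]
      gcongr
    have h8 : ‖a ^ (β-1) • (z - w)‖ ≤ a ^ β * (ε/2) := by
      rw [norm_smul, Real.norm_of_nonneg (by positivity)]
      calc a ^ (β-1) * ‖z - w‖ ≤ a ^ (β-1) * (ε/2 * a) := by gcongr
        _ = (a ^ (β-1) * a) * (ε/2) := by ring
        _ = _ := by rw [rpow_sub_one_mul h0.le hβ]
    rw [norm_radial hβ, norm_radial hβ, h6]
    refine (norm_add_le _ _).trans ?_
    have : 0 ≤ b ^ β := by positivity
    nlinarith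
  refine ⟨min (δ/4) (ε/4), by positivity, fun z w h => ?_⟩
  rcases le_total ‖w‖ ‖z‖ with h' | h'
  · exact main z w h' h
  · rw [norm_sub_rev, add_comm]
    exact main w z h' (by rw [norm_sub_rev, add_comm]; exact h)

theorem radial_HUC' {β : ℝ} (hβ : 0 < β) : HUC (fun z : E => radial β z) (fun z : E => z) := by
  have := (radial_HUC (E := E) (inv_pos.2 hβ)).comp (fun z : E => radial β z)
  simpa only [Function.comp_def, radial_inv hβ] using this

end radial


section mazur

theorem Lp_norm_rpow {μ : Measure ℝ} {r : ℝ} (hr : 1 ≤ r) [Fact (1 ≤ ENNReal.ofReal r)]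
    (f : Lp ℝ (ENNReal.ofReal r) μ) : ‖f‖ ^ r = ∫ x, ‖f x‖ ^ r ∂μ := by
  have hr0 : 0 < r := by linarith
  have h := (Lp.memLp f).eLpNorm_eq_integral_rpow_norm (by simpa using hr0) ENNReal.ofReal_ne_top
  rw [ENNReal.toReal_ofReal hr0.le] at h
  rw [Lp.norm_def, h, ENNReal.toReal_ofReal (by positivity), ← Real.rpow_mul (by positivity),
    inv_mul_cancel₀ hr0.ne', Real.rpow_one]

theorem Lp_norm_rpow_sub {μ : Measure ℝ} {r : ℝ} (hr : 1 ≤ r) [Fact (1 ≤ ENNReal.ofReal r)]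
    (f g : Lp ℝ (ENNReal.ofReal r) μ) : ‖f - g‖ ^ r = ∫ x, ‖f x - g x‖ ^ r ∂μ := by
  rw [Lp_norm_rpow hr]
  refine integral_congr_ae ?_
  filter_upwards [Lp.coeFn_sub f g] with x hx
  rw [hx, Pi.sub_apply]

theorem Lp_int_rpow {μ : Measure ℝ} {r : ℝ} (hr : 1 ≤ r) [Fact (1 ≤ ENNReal.ofReal r)]
    (f : Lp ℝ (ENNReal.ofReal r) μ) : Integrable (fun x => ‖f x‖ ^ r) μ := by
  have := (Lp.memLp f).integrable_norm_rpow (by simpa using (by linarith : 0 < r)) ENNReal.ofReal_ne_top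
  rwa [ENNReal.toReal_ofReal (by linarith)] at this

theorem Lp_int_rpow_sub {μ : Measure ℝ} {r : ℝ} (hr : 1 ≤ r) [Fact (1 ≤ ENNReal.ofReal r)]
    (f g : Lp ℝ (ENNReal.ofReal r) μ) : Integrable (fun x => ‖f x - g x‖ ^ r) μ := by
  refine (Lp_int_rpow hr (f - g)).congr ?_
  filter_upwards [Lp.coeFn_sub f g] with x hx
  rw [hx, Pi.sub_apply]

theorem Lp_ineq {μ : Measure ℝ} {r s : ℝ} (hr : 1 ≤ r) (hs : 1 ≤ s) [Fact (1 ≤ ENNReal.ofReal r)]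
    [Fact (1 ≤ ENNReal.ofReal s)] {ε C : ℝ}
    (f g : Lp ℝ (ENNReal.ofReal r) μ) (F G : Lp ℝ (ENNReal.ofReal s) μ)
    (H : ∀ᵐ x ∂μ, ‖F x - G x‖ ^ s ≤ ε * (‖f x‖ ^ r + ‖g x‖ ^ r) + C * ‖f x - g x‖ ^ r) :
    ‖F - G‖ ^ s ≤ ε * (‖f‖ ^ r + ‖g‖ ^ r) + C * ‖f - g‖ ^ r := by
  have i1 : Integrable (fun x => ε * (‖f x‖ ^ r + ‖g x‖ ^ r)) μ :=
    ((Lp_int_rpow hr f).add (Lp_int_rpow hr g)).const_mul ε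
  have i2 : Integrable (fun x => C * ‖f x - g x‖ ^ r) μ := (Lp_int_rpow_sub hr f g).const_mul C
  rw [Lp_norm_rpow_sub hs, Lp_norm_rpow_sub hr, Lp_norm_rpow hr, Lp_norm_rpow hr,
    ← integral_add (Lp_int_rpow hr f) (Lp_int_rpow hr g), ← integral_const_mul, ← integral_const_mul,
    ← integral_add i1 i2]
  exact integral_mono_ae (Lp_int_rpow_sub hs F G) (i1.add i2) H

theorem exists_mazur {μ : Measure ℝ} {r s : ℝ} (hr : 1 ≤ r) (hs : 1 ≤ s) [Fact (1 ≤ ENNReal.ofReal r)]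
    [Fact (1 ≤ ENNReal.ofReal s)] :
    ∃ Φ : Lp ℝ (ENNReal.ofReal r) μ → Lp ℝ (ENNReal.ofReal s) μ,
      (∀ f, ‖Φ f‖ ^ s = ‖f‖ ^ r) ∧ HUC (fun f => f) Φ ∧ HUC Φ (fun f => f) := by
  have hr0 : 0 < r := by linarith
  have hs0 : 0 < s := by linarith
  have hβ : 0 < r / s := by positivity
  have hnr : ∀ a : ℝ, ‖radial (r/s) a‖ ^ s = ‖a‖ ^ r := fun a => by
    rw [norm_radial hβ, ← Real.rpow_mul (norm_nonneg _), div_mul_cancel₀ _ hs0.ne']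
  have hmeas : Measurable (radial (r/s) : ℝ → ℝ) := by
    unfold radial
    exact (measurable_norm.pow_const _).smul measurable_id
  have hmem : ∀ f : Lp ℝ (ENNReal.ofReal r) μ, MemLp (fun x => radial (r/s) (f x)) (ENNReal.ofReal s) μ := by
    intro f
    have hae : AEStronglyMeasurable (fun x => radial (r/s) (f x)) μ :=
      (hmeas.comp_aemeasurable (Lp.aestronglyMeasurable f).aemeasurable).aestronglyMeasurable
    rw [← integrable_norm_rpow_iff hae (by simpa using hs0) ENNReal.ofReal_ne_top,
      ENNReal.toReal_ofReal hs0.le]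
    simp only [hnr]
    exact Lp_int_rpow hr f
  let Φ : Lp ℝ (ENNReal.ofReal r) μ → Lp ℝ (ENNReal.ofReal s) μ := fun f => (hmem f).toLp _
  have hΦ : ∀ f, ∀ᵐ x ∂μ, Φ f x = radial (r/s) (f x) := fun f => (hmem f).coeFn_toLp
  have hn : ∀ f, ‖Φ f‖ ^ s = ‖f‖ ^ r := fun f => by
    rw [Lp_norm_rpow hs, Lp_norm_rpow hr]
    refine integral_congr_ae ?_
    filter_upwards [hΦ f] with x hx
    rw [hx, hnr]
  refine ⟨Φ, hn, ?_, ?_⟩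
  · refine HUC.of_ineq hs0 hr0 hn fun ε hε => ?_
    obtain ⟨C, hC, H⟩ := (radial_HUC (E := ℝ) hβ).ineq hs0 hr0 hnr ε hε
    refine ⟨C, hC, fun f g => Lp_ineq hr hs f g (Φ f) (Φ g) ?_⟩
    filter_upwards [hΦ f, hΦ g] with x h1 h2
    rw [h1, h2]
    exact H _ _
  · refine HUC.of_ineq hr0 hs0 (fun f => (hn f).symm) fun ε hε => ?_
    obtain ⟨C, hC, H⟩ := (radial_HUC' (E := ℝ) hβ).ineq hr0 hs0 (fun a => (hnr a).symm) ε hε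
    refine ⟨C, hC, fun f g => Lp_ineq hs hr (Φ f) (Φ g) f g ?_⟩
    filter_upwards [hΦ f, hΦ g] with x h1 h2
    rw [h1, h2]
    exact H _ _

/-- a map into Hilbert space with power-type control -/
theorem exists_hilbert_map {r q : ℝ} (hr : 1 ≤ r) (hq : 1 ≤ q) [Fact (1 ≤ ENNReal.ofReal r)] :
    ∃ (H : Type) (_ : NormedAddCommGroup H) (_ : InnerProductSpace ℝ H) (Ψ : LSp r → H),
      (∀ ε : ℝ, 0 < ε → ∃ C : ℝ, 0 < C ∧ ∀ z w,
        ‖Ψ z - Ψ w‖ ^ 2 ≤ ε * (‖z‖ ^ q + ‖w‖ ^ q) + C * ‖z - w‖ ^ q) ∧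
      (∀ ε : ℝ, 0 < ε → ∃ C : ℝ, 0 < C ∧ ∀ z w,
        ‖z - w‖ ^ q ≤ ε * (‖z‖ ^ q + ‖w‖ ^ q) + C * ‖Ψ z - Ψ w‖ ^ 2) := by
  have h2 : ENNReal.ofReal 2 = 2 := by simp
  have : Fact (1 ≤ ENNReal.ofReal 2) := ⟨by rw [h2]; norm_num⟩
  obtain ⟨Φ, hn, hu1, hu2⟩ := exists_mazur
    (μ := (volume : Measure ℝ).restrict (Set.Icc 0 1)) hr (one_le_two : (1:ℝ) ≤ 2)
  have hr0 : 0 < r := by linarith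
  have hq0 : 0 < q := by linarith
  have hβ : 0 < q / r := by positivity
  generalize ENNReal.ofReal 2 = two at *
  subst h2
  let Ψ : LSp r → Lp ℝ 2 ((volume : Measure ℝ).restrict (Set.Icc 0 1)) := fun z => radial (q/r) (Φ z)
  have k1 : HUC (fun z => z) Ψ := hu1.trans ((radial_HUC hβ).comp Φ)
  have k2 : HUC Ψ (fun z => z) := HUC.trans ((radial_HUC' hβ).comp Φ) hu2
  have kn : ∀ z, ‖Ψ z‖ ^ (2:ℝ) = ‖z‖ ^ q := fun z => by
    rw [norm_radial hβ, ← Real.rpow_mul (norm_nonneg _), mul_comm, Real.rpow_mul (norm_nonneg _), hn,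
      ← Real.rpow_mul (norm_nonneg _), mul_div_cancel₀ _ hr0.ne']
  refine ⟨_, inferInstance, inferInstance, Ψ, ?_, ?_⟩
  · intro ε hε
    obtain ⟨C, hC, H⟩ := k1.ineq two_pos hq0 kn ε hε
    exact ⟨C, hC, fun z w => by simpa only [Real.rpow_two] using H z w⟩
  · intro ε hε
    obtain ⟨C, hC, H⟩ := k2.ineq hq0 two_pos (fun z => (kn z).symm) ε hε
    refine ⟨C, hC, fun z w => ?_⟩
    have := H z w
    rw [kn, kn] at this
    simpa only [Real.rpow_two] using this

end mazur


section kernel2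
variable {G : Type} [AddCommGroup G] [Fintype G] [DecidableEq G]

theorem kstep_nonneg {p : ℝ} (h0 : 0 ≤ p) (h1 : p ≤ 1) (h x y : G) : 0 ≤ kstep p h x y := by
  have hk : ∀ a b : G, 0 ≤ kdel a b := fun a b => by unfold kdel; split_ifs <;> norm_num
  have := hk x y; have := hk (x+h) y; have := hk (x-h) y
  have : 0 ≤ 1 - p := by linarith
  unfold kstep
  positivity

theorem kstep_ne {p : ℝ} {h x y : G} (hne : kstep p h x y ≠ 0) :
    y = x ∨ y = x + h ∨ y = x - h := by
  by_contra! hc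
  apply hne
  simp [kstep, kdel, hc.1.symm, hc.2.1.symm, hc.2.2.symm]

theorem kstep_diag {p : ℝ} {h x : G} (hh : h ≠ 0) : kstep p h x x = 1 - p := by
  simp [kstep, kdel, hh]

theorem kprod_sum_one {n : ℕ} (p : ℝ) (h : G) (x : Fin n → G) :
    ∑ y : Fin n → G, ∏ i, kstep p h (x i) (y i) = 1 := by
  have := Finset.prod_univ_sum (fun _ : Fin n => (Finset.univ : Finset G))
      (fun i y => kstep p h (x i) y)
  simp only [kstep_sum_one, Finset.prod_const_one, Fintype.piFinset_univ] at this
  exact this.symm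

theorem torus_step {K : ℕ} (g : G) (hg : 2 ^ K • g ≠ 0)
    {H : Type*} [NormedAddCommGroup H] [InnerProductSpace ℝ H] (I : Finset ℕ)
    (f : ℕ → (Fin (4 ^ K) → G) → H) {c R : ℝ} (hc : 0 ≤ c)
    (hlow : ∀ x y, (∃ i, y i = x i + 2 ^ K • g ∨ y i = x i - 2 ^ K • g) →
      c ≤ ∑ m ∈ I, ‖f m x - f m y‖ ^ 2)
    (hup : ∀ x y, (∀ i, y i = x i ∨ y i = x i + g ∨ y i = x i - g) →
      ∑ m ∈ I, ‖f m x - f m y‖ ^ 2 ≤ R) : c / 3 ≤ R := by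
  set P : ℝ := (1/2) / 4 ^ K with hP
  have hP0 : 0 ≤ P := by positivity
  have hP1 : P ≤ 1/2 := div_le_self (by norm_num) (one_le_pow₀ (by norm_num))
  have hV : 0 < (Fintype.card (Fin (4 ^ K) → G) : ℝ) := by
    have : Nonempty (Fin (4 ^ K) → G) := ⟨fun _ => 0⟩
    exact_mod_cast Fintype.card_pos
  have hsum : ∑ x, ∑ y, (∏ i, kstep P (2 ^ K • g) (x i) (y i)) * ∑ m ∈ I, ‖f m x - f m y‖ ^ 2 ≤
    ∑ x, ∑ y, (∏ i, kstep (1/2) g (x i) (y i)) * ∑ m ∈ I, ‖f m x - f m y‖ ^ 2 := by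
    have hsw : ∀ W : (Fin (4 ^ K) → G) → (Fin (4 ^ K) → G) → ℝ,
        ∑ x, ∑ y, W x y * ∑ m ∈ I, ‖f m x - f m y‖ ^ 2 =
        ∑ m ∈ I, ∑ x, ∑ y, W x y * ‖f m x - f m y‖ ^ 2 := by
      intro W
      simp only [Finset.mul_sum]
      symm
      rw [Finset.sum_comm]
      refine Finset.sum_congr rfl fun x _ => ?_
      rw [Finset.sum_comm]
    rw [hsw, hsw]
    exact Finset.sum_le_sum fun m _ => kernel_ineq K g (f m)
  have hR : ∑ x, ∑ y, (∏ i, kstep (1/2) g (x i) (y i)) * ∑ m ∈ I, ‖f m x - f m y‖ ^ 2 ≤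
      Fintype.card (Fin (4 ^ K) → G) * R := by
    have : ∀ x, ∑ y, (∏ i, kstep (1/2) g (x i) (y i)) * ∑ m ∈ I, ‖f m x - f m y‖ ^ 2 ≤ R := by
      intro x
      calc _ ≤ ∑ y : Fin (4 ^ K) → G, (∏ i, kstep (1/2) g (x i) (y i)) * R := by
            refine Finset.sum_le_sum fun y _ => ?_
            by_cases h0 : (∏ i, kstep (1/2) g (x i) (y i)) = 0
            · rw [h0, zero_mul, zero_mul]
            · refine mul_le_mul_of_nonneg_left (hup x y fun i => ?_)
                (Finset.prod_nonneg fun i _ => kstep_nonneg (by norm_num) (by norm_num) _ _ _)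
              exact kstep_ne (Finset.prod_ne_zero_iff.1 h0 i (Finset.mem_univ i))
        _ = R := by rw [← Finset.sum_mul, kprod_sum_one, one_mul]
    refine (Finset.sum_le_sum fun x _ => this x).trans ?_
    simp
  have hpow : (1 - P) ^ (4 ^ K) ≤ 2/3 := by
    have h1 : (1 - P) ^ (4 ^ K) * (1 + P) ^ (4 ^ K) ≤ 1 := by
      rw [← mul_pow]
      exact pow_le_one₀ (by nlinarith) (by nlinarith)
    have h2 := one_add_mul_le_pow (a := P) (by linarith) (4 ^ K)
    have h3 : ((4 ^ K : ℕ) : ℝ) * P = 1/2 := by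
      rw [hP]; push_cast; field_simp
    rw [h3] at h2
    have h4 : 0 ≤ (1 - P) ^ (4 ^ K) := pow_nonneg (by linarith) _
    nlinarith
  have hL : Fintype.card (Fin (4 ^ K) → G) * (c / 3) ≤
      ∑ x, ∑ y, (∏ i, kstep P (2 ^ K • g) (x i) (y i)) * ∑ m ∈ I, ‖f m x - f m y‖ ^ 2 := by
    have : ∀ x, c / 3 ≤ ∑ y, (∏ i, kstep P (2 ^ K • g) (x i) (y i)) * ∑ m ∈ I, ‖f m x - f m y‖ ^ 2 := by
      intro x
      have h1 : ∑ y, (∏ i, kstep P (2 ^ K • g) (x i) (y i)) * (c - c * kdel x y) ≤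
          ∑ y, (∏ i, kstep P (2 ^ K • g) (x i) (y i)) * ∑ m ∈ I, ‖f m x - f m y‖ ^ 2 := by
        refine Finset.sum_le_sum fun y _ => ?_
        by_cases h0 : (∏ i, kstep P (2 ^ K • g) (x i) (y i)) = 0
        · rw [h0, zero_mul, zero_mul]
        · refine mul_le_mul_of_nonneg_left ?_
                (Finset.prod_nonneg fun i _ => kstep_nonneg hP0 (by linarith) _ _ _)
          by_cases hxy : x = y
          · subst hxy; simp [kdel]
          · simp only [kdel, if_neg hxy, mul_zero, sub_zero]
            obtain ⟨i, hi⟩ := Function.ne_iff.1 hxy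
            refine hlow x y ⟨i, ?_⟩
            rcases kstep_ne (Finset.prod_ne_zero_iff.1 h0 i (Finset.mem_univ i)) with h | h
            · exact absurd h.symm hi
            · exact h
      refine le_trans ?_ h1
      simp only [mul_sub, Finset.sum_sub_distrib]
      rw [← Finset.sum_mul, kprod_sum_one]
      have h2 : ∑ y, (∏ i, kstep P (2 ^ K • g) (x i) (y i)) * (c * kdel x y) = (1-P)^(4^K) * c := by
        have : ∀ y, (∏ i, kstep P (2 ^ K • g) (x i) (y i)) * (c * kdel x y) =
          kdel x y * ((∏ i, kstep P (2 ^ K • g) (x i) (y i)) * c) := fun y => by ring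
        simp only [this]
        rw [kdel_sum]
        simp [kstep_diag hg]
      rw [h2]
      nlinarith
    refine le_trans ?_ (Finset.sum_le_sum fun x _ => this x)
    simp
  have := hL.trans (hsum.trans hR)
  exact le_of_mul_le_mul_left this hV

end kernel2


theorem toAC_one (K : ℕ) : ‖ZMod.toAddCircle (1 : ZMod (2^(K+1)))‖ = 1 / 2^(K+1) := by
  have := ZMod.toAddCircle_natCast (N := 2^(K+1)) 1
  rw [Nat.cast_one] at this
  rw [this]
  have h1 : |((1:ℕ):ℝ) / ((2^(K+1) : ℕ):ℝ)| = 1 / 2^(K+1) := by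
    push_cast
    rw [abs_of_nonneg (by positivity)]
  rw [← h1, AddCircle.norm_coe_eq_abs_iff 1 one_ne_zero, h1, abs_one, pow_succ]
  gcongr
  have : (1:ℝ) ≤ 2^K := one_le_pow₀ (by norm_num)
  linarith

theorem toAC_half (K : ℕ) : ‖ZMod.toAddCircle (2^K • (1 : ZMod (2^(K+1))))‖ = 1 / 2 := by
  have := ZMod.toAddCircle_natCast (N := 2^(K+1)) (2^K)
  rw [nsmul_one, this]
  have h1 : |((2^K:ℕ):ℝ) / ((2^(K+1) : ℕ):ℝ)| = 1 / 2 := by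
    push_cast
    rw [abs_of_nonneg (by positivity), pow_succ]
    field_simp
  rw [← h1, AddCircle.norm_coe_eq_abs_iff 1 one_ne_zero, h1, abs_one]

theorem part3 {r p q : ℝ} (hr : 1 ≤ r) (hp : 1 ≤ p) (hq : 1 ≤ q) [Fact (1 ≤ ENNReal.ofReal r)] :
    ¬ BorelReducible (ESum cZeroSp p) (ESum (LSp r) q) := by
  classical
  intro hred
  have hp0 : 0 < p := by linarith
  have hq0 : 0 < q := by linarith
  obtain ⟨H, _, _, Ψ, hΨ1, hΨ2⟩ := exists_hilbert_map hr hq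
  have hA := fun K : ℕ => aharoni_snow (Fin (4^K) → UnitAddCircle) (α := 1) one_pos le_rfl
  choose A hAc hA using hA
  simp only [Real.rpow_one] at hA
  let tor : (K : ℕ) → (Fin (4^K) → ZMod (2^(K+1))) → (Fin (4^K) → UnitAddCircle) :=
    fun K w i => ZMod.toAddCircle (w i)
  let e : (Σ K : ℕ, Fin (4^K) → ZMod (2^(K+1))) → cZeroSp := fun a => A a.1 (tor a.1 a.2)
  have hNZ : ∀ K : ℕ, NeZero (2^(K+1)) := fun K => inferInstance
  obtain ⟨c, C, hc, hC, HD⟩ := thmD hp hq hred e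
  -- metric facts
  have d2 : ∀ K w w', dist (tor K w) (tor K w') ≤ 1/2 := by
    intro K w w'
    rw [dist_pi_le_iff (by norm_num)]
    intro i
    rw [dist_eq_norm]
    simpa using AddCircle.norm_le_half_period 1 one_ne_zero (x := tor K w i - tor K w' i)
  have d3 : ∀ K w w', (∀ i, w' i = w i ∨ w' i = w i + 1 ∨ w' i = w i - 1) →
      dist (tor K w) (tor K w') ≤ 1 / 2^(K+1) := by
    intro K w w' h
    rw [dist_pi_le_iff (by positivity)]
    intro i
    rw [dist_comm, dist_eq_norm]
    show ‖ZMod.toAddCircle (w' i) - ZMod.toAddCircle (w i)‖ ≤ _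
    rcases h i with h | h | h
    · rw [h, sub_self, norm_zero]; positivity
    · rw [h, map_add, add_sub_cancel_left, toAC_one]
    · rw [h, map_sub, sub_sub_cancel_left, norm_neg, toAC_one]
  have d4 : ∀ K w w', (∃ i, w' i = w i + 2^K • 1 ∨ w' i = w i - 2^K • 1) →
      1/2 ≤ dist (tor K w) (tor K w') := by
    rintro K w w' ⟨i, h⟩
    refine le_trans (le_of_eq ?_) (dist_le_pi_dist _ _ i)
    rw [dist_comm, dist_eq_norm]
    show _ = ‖ZMod.toAddCircle (w' i) - ZMod.toAddCircle (w i)‖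
    rcases h with h | h
    · rw [h, map_add, add_sub_cancel_left, toAC_half]
    · rw [h, map_sub, sub_sub_cancel_left, norm_neg, toAC_half]
  have hinj : ∀ K w w', w ≠ w' → e ⟨K, w⟩ ≠ e ⟨K, w'⟩ := by
    intro K w w' hne h
    have h1 := (hA K (tor K w) (tor K w')).1
    have h2 : A K (tor K w) = A K (tor K w') := h
    rw [h2, sub_self, norm_zero] at h1
    have h3 : dist (tor K w) (tor K w') = 0 := le_antisymm (by linarith) dist_nonneg
    rw [dist_eq_zero] at h3
    apply hne
    funext i
    exact ZMod.toAddCircle_injective _ (congrFun h3 i)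
  set c0 : ℝ := c * (1/20)^p with hc0
  have hc0p : 0 < c0 := by positivity
  obtain ⟨C2, hC2, H2⟩ := hΨ2 (c0 / (4 * C)) (by positivity)
  set c2 : ℝ := c0 / 2 / C2 with hc2
  have hc2p : 0 < c2 := by positivity
  obtain ⟨C1, hC1, H1⟩ := hΨ1 (c2 / (12 * C)) (by positivity)
  have key : ∀ K : ℕ, c2 / 3 ≤ c2 / 6 + C1 * (C * ((1/2)^(K+1)) ^ p) := by
    intro K
    obtain ⟨I, τ, hI⟩ := HD (Finset.univ.image fun w => ⟨K, w⟩)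
    have hmem : ∀ w, (⟨K, w⟩ : Σ K : ℕ, Fin (4^K) → ZMod (2^(K+1))) ∈
      (Finset.univ.image fun w => (⟨K, w⟩ : Σ K : ℕ, Fin (4^K) → ZMod (2^(K+1)))) :=
      fun w => Finset.mem_image_of_mem _ (Finset.mem_univ w)
    let T : ℕ → (Fin (4^K) → ZMod (2^(K+1))) → LSp r := fun m w => τ ⟨K, w⟩ m - τ ⟨K, 0⟩ m
    have hT : ∀ m w w', T m w - T m w' = τ ⟨K, w⟩ m - τ ⟨K, w'⟩ m := fun m w w' => by
      simp only [T]; abel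
    have t1 : ∀ w w', ∑ m ∈ I, ‖T m w - T m w'‖ ^ q ≤ C * dist (tor K w) (tor K w') ^ p := by
      intro w w'
      by_cases hne : w = w'
      · subst hne
        simp only [sub_self, norm_zero, Real.zero_rpow hq0.ne', Finset.sum_const_zero]
        positivity
      · simp only [hT]
        refine ((hI _ (hmem w) _ (hmem w') (hinj K w w' hne)).2).trans ?_
        gcongr
        exact (hA K (tor K w) (tor K w')).2
    have t2 : ∀ w w', 1/2 ≤ dist (tor K w) (tor K w') → c0 ≤ ∑ m ∈ I, ‖T m w - T m w'‖ ^ q := by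
      intro w w' hd
      have hne : w ≠ w' := by
        rintro rfl
        rw [dist_self] at hd; norm_num at hd
      simp only [hT]
      refine le_trans ?_ ((hI _ (hmem w) _ (hmem w') (hinj K w w' hne)).1)
      rw [hc0]
      gcongr
      refine le_trans ?_ (hA K (tor K w) (tor K w')).1
      linarith
    have t3 : ∀ w, ∑ m ∈ I, ‖T m w‖ ^ q ≤ C := by
      intro w
      have h1 := t1 w 0
      have h2 : ∀ m, T m 0 = 0 := fun m => sub_self _
      simp only [h2, sub_zero] at h1
      refine h1.trans ?_
      have : dist (tor K w) (tor K 0) ^ p ≤ 1 :=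
        Real.rpow_le_one dist_nonneg ((d2 K _ _).trans (by norm_num)) hp0.le
      nlinarith
    have h12 : ∀ w w', ∑ m ∈ I, ‖Ψ (T m w) - Ψ (T m w')‖ ^ 2 ≤
        c2 / 6 + C1 * ∑ m ∈ I, ‖T m w - T m w'‖ ^ q := by
      intro w w'
      refine (Finset.sum_le_sum fun m _ => H1 (T m w) (T m w')).trans ?_
      rw [Finset.sum_add_distrib, ← Finset.mul_sum, ← Finset.mul_sum, Finset.sum_add_distrib]
      have : c2 / (12 * C) * (∑ m ∈ I, ‖T m w‖ ^ q + ∑ m ∈ I, ‖T m w'‖ ^ q) ≤ c2 / (12 * C) * (C + C) := by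
        gcongr
        · exact t3 w
        · exact t3 w'
      have h3 : c2 / (12 * C) * (C + C) = c2 / 6 := by field_simp; norm_num
      linarith
    have h21 : ∀ w w', ∑ m ∈ I, ‖T m w - T m w'‖ ^ q ≤ c0 / 2 + C2 * ∑ m ∈ I, ‖Ψ (T m w) - Ψ (T m w')‖ ^ 2 := by
      intro w w'
      refine (Finset.sum_le_sum fun m _ => H2 (T m w) (T m w')).trans ?_
      rw [Finset.sum_add_distrib, ← Finset.mul_sum, ← Finset.mul_sum, Finset.sum_add_distrib]
      have : c0 / (4 * C) * (∑ m ∈ I, ‖T m w‖ ^ q + ∑ m ∈ I, ‖T m w'‖ ^ q) ≤ c0 / (4 * C) * (C + C) := by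
        gcongr
        · exact t3 w
        · exact t3 w'
      have h3 : c0 / (4 * C) * (C + C) = c0 / 2 := by field_simp; norm_num
      linarith
    refine torus_step (K := K) (1 : ZMod (2^(K+1))) ?_ I (fun m w => Ψ (T m w)) hc2p.le ?_ ?_
    · intro h0
      have := toAC_half K
      rw [h0, map_zero, norm_zero] at this
      norm_num at this
    · intro w w' hw
      have h1 := t2 w w' (d4 K w w' hw)
      have h2 := h21 w w'
      rw [hc2, div_le_iff₀ hC2]
      linarith
    · intro w w' hw
      refine (h12 w w').trans ?_
      have h1 := t1 w w'
      have h2 := d3 K w w' hw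
      rw [← one_div_pow] at h2
      gcongr
      refine h1.trans ?_
      gcongr
  have hl : Tendsto (fun K : ℕ => c2 / 6 + C1 * (C * (((1/2:ℝ))^(K+1)) ^ p)) atTop
      (𝓝 (c2 / 6 + C1 * (C * 0))) := by
    have h1 : Tendsto (fun s : ℕ => (1/2:ℝ)^(s+1)) atTop (𝓝 0) :=
      (tendsto_pow_atTop_nhds_zero_of_lt_one (by norm_num) (by norm_num)).comp (tendsto_add_atTop_nat 1)
    have h2 := h1.rpow_const (p := p) (Or.inr hp0.le)
    rw [Real.zero_rpow hp0.ne'] at h2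
    exact tendsto_const_nhds.add ((h2.const_mul C).const_mul C1)
  have := ge_of_tendsto hl (Eventually.of_forall key)
  linarith


theorem c0_space_reducibility (r p q : ℝ) (hr : 1 ≤ r) (hp : 1 ≤ p) (hq : 1 ≤ q)
    [Fact (1 ≤ ENNReal.ofReal r)] :
    BorelBireducible (ESum CunitSp p) (ESum cZeroSp p) ∧
    BorelReducible (ESum (LSp r) p) (ESum cZeroSp p) ∧
    ¬ BorelReducible (ESum cZeroSp p) (ESum (LSp r) q) ∧
    (p < q → BorelReducible (ESum cZeroSp p) (ESum cZeroSp q) ∧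
      ¬ BorelReducible (ESum cZeroSp q) (ESum cZeroSp p)) := by
  exact ⟨part1 hp, part2 hp, part3 hr hp hq, fun hpq => ⟨reducible_snow (by linarith) hpq.le, part4b hp hpq⟩⟩
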